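/- arXiv:2502.15048 — 5 statements merged into one kernel-verified Lean document; each statement's English description precedes it below -/
import Mathlib

section
/- Let (R, m, k) be a commutative Noetherian local ring of dimension d and N an R-module (not necessarily finitely generated). If the injective dimension of N is finite, then it is at most d; likewise if the flat dimension of N is finite, then it is at most d. -/
open CategoryTheory IsLocalRing

/-- `id_R N ≤ n`, expressed by vanishing of `Ext^i_R(A, N)` for all `A` and all `i > n`. -/
noncomputable def injDimLE (R : Type) [CommRing R]
    (N : Type) [AddCommGroup N] [Module R N] (n : ℕ) : Prop :=
  ∀ (A : ModuleCat R) (i : ℕ), n < i →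
    Subsingleton (((Ext R (ModuleCat R) i).obj (Opposite.op A)).obj (ModuleCat.of R N))

/-- `fd_R N ≤ n`, expressed by vanishing of `Tor_i^R(A, N)` for all `A` and all `i > n`. -/
noncomputable def flatDimLE (R : Type) [CommRing R]
    (N : Type) [AddCommGroup N] [Module R N] (n : ℕ) : Prop :=
  ∀ (A : ModuleCat R) (i : ℕ), n < i →
    Subsingleton (((Tor (ModuleCat R) i).obj A).obj (ModuleCat.of R N))

namespace Bass
open Abelian

section kill
variable {R : Type} [CommRing R]

/-- every element of `Ext^i(M,N)` is killed by something outside `p`. -/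
def Kill (p : Ideal R) (M N : ModuleCat.{0} R) (i : ℕ) : Prop :=
  ∀ e : Abelian.Ext M N i, ∃ s, s ∉ p ∧ s • e = 0

variable {p : Ideal R} [hp : p.IsPrime] {N : ModuleCat.{0} R} {S : ShortComplex (ModuleCat.{0} R)}

lemma kill_mid (hS : S.ShortExact) {i : ℕ} (h1 : Kill p S.X₁ N i) (h3 : Kill p S.X₃ N i) : Kill p S.X₂ N i := by
  intro e
  obtain ⟨s, hs, h⟩ := h1 ((Ext.mk₀ S.f).comp e (zero_add i))
  rw [← Ext.comp_smul] at h
  obtain ⟨e3, he3⟩ := Ext.contravariant_sequence_exact₂ hS N _ h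
  obtain ⟨t, ht, h'⟩ := h3 e3
  refine ⟨t * s, fun h => (hp.mem_or_mem h).elim ht hs, ?_⟩
  rw [mul_smul, ← he3, ← Ext.comp_smul, h', Ext.comp_zero]

lemma kill_right (hS : S.ShortExact) {i : ℕ} (h1 : Kill p S.X₁ N i) (h2 : Kill p S.X₂ N (i+1)) :
    Kill p S.X₃ N (i+1) := by
  intro e
  obtain ⟨s, hs, h⟩ := h2 ((Ext.mk₀ S.g).comp e (zero_add _))
  rw [← Ext.comp_smul] at h
  obtain ⟨e3, he3⟩ := Ext.contravariant_sequence_exact₃ hS N _ h (add_comm 1 i)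
  obtain ⟨t, ht, h'⟩ := h1 e3
  refine ⟨t * s, fun h => (hp.mem_or_mem h).elim ht hs, ?_⟩
  rw [mul_smul, ← he3, ← Ext.comp_smul, h', Ext.comp_zero]

lemma smul_eq_mk_comp {M N : ModuleCat.{0} R} {i : ℕ} (s : R) (e : Abelian.Ext M N i) :
    s • e = (Ext.mk₀ (s • 𝟙 M)).comp e (zero_add i) := by
  rw [Ext.mk₀_smul, Ext.smul_comp, Ext.mk₀_id_comp]

lemma kill_of_smul {M N : ModuleCat.{0} R} {i : ℕ} {s : R} (hs : s ∉ p) (h : ∀ m : M, s • m = 0) :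
    Kill p M N i := by
  intro e
  refine ⟨s, hs, ?_⟩
  have : s • 𝟙 M = 0 := by
    ext m
    exact h m
  rw [smul_eq_mk_comp, this, Ext.mk₀_zero, Ext.zero_comp]

lemma sub_mid (hS : S.ShortExact) {i : ℕ} (h1 : Subsingleton (Abelian.Ext S.X₁ N i))
    (h3 : Subsingleton (Abelian.Ext S.X₃ N i)) : Subsingleton (Abelian.Ext S.X₂ N i) := by
  refine subsingleton_of_forall_eq 0 fun e => ?_
  obtain ⟨e3, he3⟩ := Ext.contravariant_sequence_exact₂ hS N e (Subsingleton.elim _ _)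
  rw [← he3, Subsingleton.elim e3 0, Ext.comp_zero]

lemma sub_zero {M N : ModuleCat.{0} R} {i : ℕ} [Subsingleton M] : Subsingleton (Abelian.Ext M N i) := by
  refine subsingleton_of_forall_eq 0 fun e => ?_
  rw [← Ext.mk₀_id_comp e, (ModuleCat.isZero_of_subsingleton M).eq_of_src (𝟙 M) 0, Ext.mk₀_zero,
    Ext.zero_comp]

lemma sub_iso {M M' N : ModuleCat.{0} R} {i : ℕ} (e : M ≅ M') (h : Subsingleton (Abelian.Ext M' N i)) :
    Subsingleton (Abelian.Ext M N i) := by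
  refine subsingleton_of_forall_eq 0 fun x => ?_
  rw [← Ext.mk₀_id_comp x, ← e.hom_inv_id, ← Ext.mk₀_comp_mk₀, Ext.comp_assoc _ _ _ (zero_add _) (zero_add _) (by simp),
    Subsingleton.elim (Ext.comp (Ext.mk₀ e.inv) x _) 0, Ext.comp_zero]

lemma sub_fin [IsNoetherianRing R] (I : Ideal R) {N : ModuleCat.{0} R} {i : ℕ}
    (h : ∀ q : Ideal R, q.IsPrime → I ≤ q → Subsingleton (Abelian.Ext (ModuleCat.of R (R ⧸ q)) N i))
    (M : Type) [AddCommGroup M] [Module R M] (hM : Module.Finite R M) (hI : ∀ a ∈ I, ∀ m : M, a • m = 0) :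
    Subsingleton (Abelian.Ext (ModuleCat.of R M) N i) := by
  induction hM using IsNoetherianRing.induction_on_isQuotientEquivQuotientPrime R with
  | subsingleton M => exact sub_zero
  | quotient M q f =>
    refine sub_iso f.toModuleIso (h q.1 q.2 fun a ha => ?_)
    have := hI a ha (f.symm (Ideal.Quotient.mk _ 1))
    rw [← map_smul, map_eq_zero_iff _ f.symm.injective] at this
    rw [← Ideal.Quotient.eq_zero_iff_mem, ← this, ← mul_one a]
    simp [Algebra.smul_def]
  | exact M1 M2 M3 f g hf hg hfg h1 h3 =>
    have hS := ModuleCat.shortComplex_shortExact (ModuleCat.shortComplexOfCompEqZero f g hfg.linearMap_comp_eq_zero)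
      hfg hf hg
    refine sub_mid hS (h1 fun a ha m => hf ?_) (h3 fun a ha m => ?_)
    · rw [map_smul, hI a ha, map_zero]
    · obtain ⟨m, rfl⟩ := hg m
      rw [← map_smul, hI a ha, map_zero]
end kill
end Bass

namespace Bass
open Abelian
section step
variable {R : Type} [CommRing R] [IsNoetherianRing R]

lemma assoc_of_min {M : Type} [AddCommGroup M] [Module R M] (k : M) {q : Ideal R}
    (hq : q ∈ (Submodule.colon (⊥ : Submodule R M) {k}).minimalPrimes) :
    IsAssociatedPrime q M :=
  isAssociatedPrime_iff.mpr ⟨hq.1.1, Submodule.exists_eq_colon_of_mem_minimalPrimes hq⟩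

lemma exists_kill {p : Ideal R} [hp : p.IsPrime] {M : Type} [AddCommGroup M] [Module R M] (K : Submodule R M)
    (hK : K.FG) (h : ∀ k ∈ K, ∃ s, s ∉ p ∧ s • k = 0) : ∃ s, s ∉ p ∧ ∀ k ∈ K, s • k = 0 := by
  induction K, hK using Submodule.fg_induction with
  | singleton x =>
    obtain ⟨s, hs, hx⟩ := h x (Submodule.mem_span_singleton_self x)
    refine ⟨s, hs, fun k hk => ?_⟩
    obtain ⟨a, rfl⟩ := Submodule.mem_span_singleton.mp hk
    rw [smul_comm, hx, smul_zero]
  | sup K1 K2 _ _ h1 h2 =>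
    obtain ⟨s, hs, hx⟩ := h1 fun k hk => h k (Submodule.mem_sup_left hk)
    obtain ⟨t, ht, hy⟩ := h2 fun k hk => h k (Submodule.mem_sup_right hk)
    refine ⟨s * t, fun h => (hp.mem_or_mem h).elim hs ht, fun k hk => ?_⟩
    obtain ⟨y, hy', z, hz, rfl⟩ := Submodule.mem_sup.mp hk
    rw [smul_add, mul_smul, mul_smul, hy z hz, smul_comm, hx y hy']
    simp

/-- the invariant -/
def Inv (p : Ideal R) (N : ModuleCat.{0} R) (J : Ideal R) (j : ℕ) : Prop :=
  J ≤ p ∧ (∀ q : Ideal R, q.IsPrime → J ≤ q → q ≤ p → (j : ℕ∞) ≤ q.height) ∧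
    ∀ i, j < i → Kill p (ModuleCat.of R (R ⧸ J)) N i

lemma step {p : Ideal R} [hp : p.IsPrime] {N : ModuleCat.{0} R} {J : Ideal R} {j : ℕ}
    (h : Inv p N J j) (hass : ¬ IsAssociatedPrime p (R ⧸ J)) : ∃ J', Inv p N J' (j+1) := by
  obtain ⟨hJ, hht, hk⟩ := h
  have hfin := associatedPrimes.finite R (R ⧸ J)
  have hfin2 : ({q | q ∈ associatedPrimes R (R ⧸ J) ∧ q ≤ p}).Finite := hfin.subset fun q hq => hq.1
  obtain ⟨x, hxp, hx⟩ : ∃ x ∈ p, ∀ q, IsAssociatedPrime q (R ⧸ J) → q ≤ p → x ∉ q := by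
    by_contra! hcon
    have h1 : (p : Set R) ⊆ ⋃ q ∈ (↑hfin2.toFinset : Set (Ideal R)), (id q : Ideal R) := by
      intro x hx
      obtain ⟨q, hq, hqp, hxq⟩ := hcon x hx
      simp only [Set.mem_iUnion]
      exact ⟨q, by simpa using ⟨hq, hqp⟩, hxq⟩
    obtain ⟨q, hq, hpq⟩ := (Ideal.subset_union_prime (f := id) ⊥ ⊥ (fun q hq _ _ => by
      simp at hq; exact hq.1.isPrime)).mp h1
    simp at hq
    exact hass (le_antisymm hq.2 hpq ▸ hq.1)
  let φ : (R ⧸ J) →ₗ[R] (R ⧸ J) := LinearMap.lsmul R (R ⧸ J) x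
  obtain ⟨s, hs, hsK⟩ : ∃ s, s ∉ p ∧ ∀ k ∈ LinearMap.ker φ, s • k = 0 := by
    refine exists_kill _ (IsNoetherian.noetherian _) fun k hk => ?_
    by_contra! hcon
    have hle : Submodule.colon (⊥ : Submodule R (R ⧸ J)) {k} ≤ p := by
      intro s hs
      by_contra hsp
      exact hcon s hsp (by simpa using hs)
    obtain ⟨q, hq, hqp⟩ := Ideal.exists_minimalPrimes_le hle
    refine hx q (assoc_of_min k hq) hqp (hq.1.2 ?_)
    have : x • k = 0 := hk
    simpa using this
  let S1 := ModuleCat.shortComplexOfCompEqZero (LinearMap.ker φ).subtype φ.rangeRestrict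
    (by ext ⟨k, hk⟩; exact hk)
  have hS1 : S1.ShortExact := ModuleCat.shortComplex_shortExact _
    (by
      intro y
      simp [S1, ModuleCat.shortComplexOfCompEqZero, Subtype.ext_iff])
    (Submodule.subtype_injective _) φ.surjective_rangeRestrict
  let J' := J ⊔ Ideal.span {x}
  have hex : Function.Exact (LinearMap.range φ).subtype (Submodule.factor (le_sup_left : J ≤ J')) := by
    intro y
    obtain ⟨r, rfl⟩ := Submodule.Quotient.mk_surjective _ y
    constructor
    · intro h
      have h : r ∈ J' := (Submodule.Quotient.mk_eq_zero J').mp h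
      obtain ⟨a, ha, z, hz, rfl⟩ := Submodule.mem_sup.mp h
      obtain ⟨b, rfl⟩ := Ideal.mem_span_singleton.mp hz
      refine ⟨⟨_, (Submodule.Quotient.mk b : R ⧸ J), rfl⟩, ?_⟩
      change x • (Submodule.Quotient.mk b : R ⧸ J) = _
      rw [← Submodule.Quotient.mk_smul, eq_comm, Submodule.Quotient.eq]
      simpa using ha
    · rintro ⟨⟨_, ⟨b, rfl⟩⟩, h⟩
      rw [← h]
      obtain ⟨b, rfl⟩ := Submodule.Quotient.mk_surjective _ b
      change Submodule.factor (le_sup_left : J ≤ J') (x • (Submodule.Quotient.mk b : R ⧸ J)) = 0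
      rw [map_smul, ← Submodule.mkQ_apply, Submodule.factor_mk, Submodule.mkQ_apply, ← Submodule.Quotient.mk_smul,
        Submodule.Quotient.mk_eq_zero]
      exact Ideal.mul_mem_right _ _ (Ideal.mem_sup_right (Ideal.mem_span_singleton_self x))
  let S2 := ModuleCat.shortComplexOfCompEqZero (LinearMap.range φ).subtype
    (Submodule.factor (le_sup_left : J ≤ J')) hex.linearMap_comp_eq_zero
  have hS2 : S2.ShortExact := ModuleCat.shortComplex_shortExact _ hex
    (Submodule.subtype_injective _) (Submodule.factor_surjective (le_sup_left : J ≤ J'))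
  refine ⟨J', sup_le hJ (by simpa [Ideal.span_le] using hxp), ?_, ?_⟩
  · intro q hq hJq hqp
    have hJq1 : J ≤ q := le_sup_left.trans hJq
    have hcol : Submodule.colon (⊥ : Submodule R (R ⧸ J)) {Submodule.Quotient.mk (1:R)} = J := by
      ext r
      rw [Submodule.mem_colon_singleton, Submodule.mem_bot, ← Submodule.Quotient.mk_smul,
        Submodule.Quotient.mk_eq_zero]
      simp
    obtain ⟨q', hq', hqq⟩ := Ideal.exists_minimalPrimes_le hJq1
    have hq'p := hq'.1.1
    have hxq' : x ∉ q' := hx q' (assoc_of_min (Submodule.Quotient.mk (1:R)) (by rwa [hcol])) (hqq.trans hqp)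
    have hlt : q' < q := lt_of_le_of_ne hqq fun h => hxq' (h ▸ hJq (Ideal.mem_sup_right (Ideal.mem_span_singleton_self x)))
    have := hht q' hq'p hq'.1.2 (hqq.trans hqp)
    push_cast
    exact (add_le_add_left this 1).trans (Ideal.height_add_one_le_of_lt_of_isPrime hlt)
  · intro i hi
    obtain ⟨i, rfl⟩ : ∃ l, i = l + 2 := ⟨i - 2, by omega⟩
    refine kill_right (S := S2) hS2 (i := i + 1) ?_ (hk _ (by omega))
    refine kill_right (S := S1) hS1 (i := i) ?_ (hk _ (by omega))
    exact kill_of_smul hs fun m => Subtype.ext (hsK m.1 m.2)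

lemma exists_inv {p : Ideal R} [hp : p.IsPrime] {N : ModuleCat.{0} R} {d : ℕ} (hd : p.height ≤ d) :
    ∃ J j, j ≤ d ∧ Inv p N J j ∧ IsAssociatedPrime p (R ⧸ J) := by
  by_contra! hcon
  have key : ∀ j : ℕ, ∃ J, Inv p N J j := by
    intro j
    induction j with
    | zero =>
      refine ⟨⊥, bot_le, by simp, fun i hi e => ⟨1, fun h => hp.ne_top ((Ideal.eq_top_iff_one _).mpr h), ?_⟩⟩
      obtain ⟨i, rfl⟩ : ∃ l, i = l + 1 := ⟨i - 1, by omega⟩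
      have : Module.Free R (R ⧸ (⊥ : Ideal R)) := Module.Free.of_equiv (Submodule.quotEquivOfEqBot (⊥ : Ideal R) rfl).symm
      have : Projective (ModuleCat.of R (R ⧸ (⊥ : Ideal R))) := 
        (IsProjective.iff_projective (R ⧸ (⊥ : Ideal R))).mp inferInstance
      rw [Ext.eq_zero_of_projective e, smul_zero]
    | succ j ih =>
      obtain ⟨J, hJ⟩ := ih
      refine step hJ (hcon J j ?_ hJ)
      exact_mod_cast (hJ.2.1 p hp hJ.1 le_rfl).trans hd
  obtain ⟨J, hJ⟩ := key (d + 1)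
  have : ((d + 1 : ℕ) : ℕ∞) ≤ d := (hJ.2.1 p hp hJ.1 le_rfl).trans hd
  have : d + 1 ≤ d := by exact_mod_cast this
  omega

lemma prime_step {p : Ideal R} [hp : p.IsPrime] {N : ModuleCat.{0} R} {d i : ℕ} (hd : p.height ≤ d) (hi : d < i)
    (h1 : ∀ (M : Type) [AddCommGroup M] [Module R M], Module.Finite R M →
      Subsingleton (Abelian.Ext (ModuleCat.of R M) N (i+1)))
    (h2 : ∀ q : Ideal R, q.IsPrime → p < q → Subsingleton (Abelian.Ext (ModuleCat.of R (R ⧸ q)) N i)) :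
    Subsingleton (Abelian.Ext (ModuleCat.of R (R ⧸ p)) N i) := by
  obtain ⟨J, j, hj, hJ, hass⟩ := exists_inv (N := N) hd
  obtain ⟨-, f, hf⟩ := (isAssociatedPrime_iff_exists_injective_linearMap _ _).mp hass
  have hS := ModuleCat.shortComplex_shortExact (ModuleCat.shortComplexOfCompEqZero f (LinearMap.range f).mkQ
    f.exact_map_mkQ_range.linearMap_comp_eq_zero) f.exact_map_mkQ_range hf (Submodule.mkQ_surjective _)
  refine subsingleton_of_forall_eq 0 fun e => ?_
  have := h1 ((R ⧸ J) ⧸ LinearMap.range f) inferInstance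
  obtain ⟨e2, he2⟩ := Ext.contravariant_sequence_exact₁ hS N e (add_comm 1 i) (Subsingleton.elim (α := Abelian.Ext (ModuleCat.of R ((R ⧸ J) ⧸ LinearMap.range f)) N (i+1)) _ _)
  obtain ⟨s, hs, hse⟩ := hJ.2.2 i (by omega) e2
  have hse : s • e = 0 := by rw [← he2, ← Ext.comp_smul, hse, Ext.comp_zero]
  let φ : (R ⧸ p) →ₗ[R] (R ⧸ p) := LinearMap.lsmul R (R ⧸ p) s
  have hφ : Function.Injective φ := by
    rw [injective_iff_map_eq_zero]
    intro y hy
    obtain ⟨r, rfl⟩ := Submodule.Quotient.mk_surjective _ y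
    change s • (Submodule.Quotient.mk r : R ⧸ p) = 0 at hy
    rw [← Submodule.Quotient.mk_smul, Submodule.Quotient.mk_eq_zero] at hy
    exact (Submodule.Quotient.mk_eq_zero _).mpr ((hp.mem_or_mem hy).resolve_left hs)
  have hS' := ModuleCat.shortComplex_shortExact (ModuleCat.shortComplexOfCompEqZero φ (LinearMap.range φ).mkQ
    φ.exact_map_mkQ_range.linearMap_comp_eq_zero) φ.exact_map_mkQ_range hφ (Submodule.mkQ_surjective _)
  have hφe : ModuleCat.ofHom φ = s • 𝟙 (ModuleCat.of R (R ⧸ p)) := rfl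
  have hQ : Subsingleton (Abelian.Ext (ModuleCat.of R ((R ⧸ p) ⧸ LinearMap.range φ)) N i) := by
    refine sub_fin (p ⊔ Ideal.span {s}) (fun q hq hle => h2 q hq ?_) _ inferInstance ?_
    · refine lt_of_le_of_ne (le_sup_left.trans hle) fun h => hs (h ▸ hle (Ideal.mem_sup_right (Ideal.mem_span_singleton_self s)))
    · intro a ha m
      obtain ⟨m, rfl⟩ := Submodule.Quotient.mk_surjective _ m
      obtain ⟨a, hap, z, hz, rfl⟩ := Submodule.mem_sup.mp ha
      obtain ⟨b, rfl⟩ := Ideal.mem_span_singleton.mp hz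
      rw [← Submodule.Quotient.mk_smul, Submodule.Quotient.mk_eq_zero]
      refine ⟨b • m, ?_⟩
      change s • b • m = _
      have : a • m = 0 := by
        obtain ⟨m, rfl⟩ := Submodule.Quotient.mk_surjective _ m
        rw [← Submodule.Quotient.mk_smul, Submodule.Quotient.mk_eq_zero]
        exact Ideal.mul_mem_right _ _ hap
      rw [add_smul, this, zero_add, mul_smul]
  obtain ⟨e3, he3⟩ := Ext.contravariant_sequence_exact₂ hS' N e (by
    rw [smul_eq_mk_comp] at hse
    exact hse)
  rw [← he3, Subsingleton.elim (α := Abelian.Ext (ModuleCat.of R ((R ⧸ p) ⧸ LinearMap.range φ)) N i) e3 0, Ext.comp_zero]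

lemma prime_all {N : ModuleCat.{0} R} {d i : ℕ} (hd : ringKrullDim R = d) (hi : d < i)
    (h1 : ∀ (M : Type) [AddCommGroup M] [Module R M], Module.Finite R M →
      Subsingleton (Abelian.Ext (ModuleCat.of R M) N (i+1))) (p : Ideal R) :
    p.IsPrime → Subsingleton (Abelian.Ext (ModuleCat.of R (R ⧸ p)) N i) := by
  induction p using WellFoundedGT.induction with
  | ind p ih =>
    intro hp
    refine prime_step (d := d) ?_ hi h1 fun q hq hpq => ih q hpq hq
    have := Ideal.height_le_ringKrullDim_of_isPrime (I := p)
    rw [hd] at this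
    exact_mod_cast this

lemma fin_all {N : ModuleCat.{0} R} {d n : ℕ} (hd : ringKrullDim R = d) [HasInjectiveDimensionLT N n] (k : ℕ) :
    ∀ i, d < i → n ≤ i + k → ∀ (M : Type) [AddCommGroup M] [Module R M], Module.Finite R M →
      Subsingleton (Abelian.Ext (ModuleCat.of R M) N i) := by
  induction k with
  | zero => intro i _ hi M _ _ _; exact HasInjectiveDimensionLT.subsingleton N n i hi _
  | succ k ih =>
    intro i hi hin M _ _ hM
    exact sub_fin ⊥ (fun q hq _ => prime_all hd hi (fun M _ _ hM => ih (i+1) (by omega) (by omega) M hM) q hq) M hM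
      (by simp)
end step
end Bass

namespace Bass
open Abelian
section inj
variable {R : Type} [CommRing R]

lemma inj_of_ext {N : ModuleCat.{0} R}
    (h : ∀ I : Ideal R, Subsingleton (Abelian.Ext (ModuleCat.of R (R ⧸ I)) N 1)) :
    Injective N := by
  have : Module.Baer R N := by
    intro I g
    have hS := ModuleCat.shortComplex_shortExact (ModuleCat.shortComplexOfCompEqZero I.subtype (Submodule.mkQ I)
      (LinearMap.exact_subtype_mkQ I).linearMap_comp_eq_zero) (LinearMap.exact_subtype_mkQ I) (Submodule.subtype_injective I) (Submodule.mkQ_surjective I)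
    obtain ⟨x, hx⟩ := Ext.contravariant_sequence_exact₁ hS N (Ext.mk₀ (ModuleCat.ofHom g)) (add_zero 1)
      (Subsingleton.elim (α := Abelian.Ext (ModuleCat.of R (R ⧸ I)) N 1) _ _)
    obtain ⟨f, rfl⟩ := Ext.homEquiv₀.symm.surjective x
    rw [Ext.homEquiv₀_symm_apply, Ext.mk₀_comp_mk₀] at hx
    have hx := (Ext.mk₀_bijective _ _).1 hx
    refine ⟨f.hom, fun y hy => ?_⟩
    exact congr($hx ⟨y, hy⟩)
  exact (Module.injective_iff_injective_object R N).mp (Module.Baer.iff_injective.mp this)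

lemma injdim_of_ext (n : ℕ) : ∀ N : ModuleCat.{0} R,
    (∀ I : Ideal R, Subsingleton (Abelian.Ext (ModuleCat.of R (R ⧸ I)) N (n+1))) →
    HasInjectiveDimensionLT N (n+1) := by
  induction n with
  | zero =>
    intro N h
    exact injective_iff_hasInjectiveDimensionLT_one.mp (inj_of_ext h)
  | succ n ih =>
    intro N h
    let ⟨I, _, f, _⟩ := EnoughInjectives.presentation N
    have injf : Function.Injective f.hom := (ModuleCat.mono_iff_injective f).mp ‹_›
    let S : ShortComplex (ModuleCat.{0} R) :=
      ModuleCat.shortComplexOfCompEqZero _ _ f.hom.exact_map_mkQ_range.linearMap_comp_eq_zero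
    have exactS := ModuleCat.shortComplex_shortExact S
      f.hom.exact_map_mkQ_range injf (Submodule.mkQ_surjective _)
    have hI : Injective S.X₂ := ‹_›
    refine (exactS.hasInjectiveDimensionLT_X₃_iff n hI).mp (ih _ fun J => ?_)
    refine subsingleton_of_forall_eq 0 fun e => ?_
    obtain ⟨x, hx⟩ := Ext.covariant_sequence_exact₃ _ exactS e rfl
      ((h J).elim _ _)
    rw [← hx, Ext.eq_zero_of_injective x, Ext.zero_comp]

/-- comparison of the two Ext's -/
lemma ext_iff (A N : ModuleCat.{0} R) (i : ℕ) :
    Subsingleton (((_root_.Ext R (ModuleCat.{0} R) (i+1)).obj (Opposite.op A)).obj N) ↔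
      Subsingleton (Abelian.Ext A N (i+1)) := by
  let P := projectiveResolution A
  have h1 : Subsingleton (((_root_.Ext R (ModuleCat.{0} R) (i+1)).obj (Opposite.op A)).obj N) ↔
      ∀ f : P.complex.X (i+1) ⟶ N, P.complex.d (i+2) (i+1) ≫ f = 0 → ∃ g, P.complex.d (i+1) i ≫ g = f := by
    rw [← ModuleCat.isZero_iff_subsingleton, (P.isoExt (R := R) (i+1) N).isZero_iff,
      ← HomologicalComplex.exactAt_iff_isZero_homology,
      HomologicalComplex.exactAt_iff' _ i (i+1) (i+2) (by simp) (by simp),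
      ShortComplex.moduleCat_exact_iff]
    rfl
  rw [h1]
  constructor
  · intro h
    refine subsingleton_of_forall_eq 0 fun e => ?_
    obtain ⟨f, hf, rfl⟩ := P.extMk_surjective e (i+2) rfl
    exact (P.extMk_eq_zero_iff f _ _ hf i rfl).mpr (h f hf)
  · intro h f hf
    exact (P.extMk_eq_zero_iff f (i+2) rfl hf i rfl).mp (Subsingleton.elim _ _)

lemma injDimLE_iff (N : Type) [AddCommGroup N] [Module R N] (n : ℕ) :
    injDimLE R N n ↔ HasInjectiveDimensionLT (ModuleCat.of R N) (n+1) := by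
  constructor
  · intro h
    refine HasInjectiveDimensionLT.mk fun i hi A e => ?_
    obtain ⟨i, rfl⟩ : ∃ l, i = l + 1 := ⟨i - 1, by omega⟩
    exact ((ext_iff _ _ _).mp (h A (i+1) hi)).elim _ _
  · intro h A i hi
    obtain ⟨i, rfl⟩ : ∃ l, i = l + 1 := ⟨i - 1, by omega⟩
    exact (ext_iff _ _ _).mpr (HasInjectiveDimensionLT.subsingleton _ (n+1) _ hi _)

lemma bound [IsNoetherianRing R] {N : ModuleCat.{0} R} {d n : ℕ} (hd : ringKrullDim R = d)
    [HasInjectiveDimensionLT N n] : HasInjectiveDimensionLT N (d+1) :=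
  injdim_of_ext d N fun _ => fin_all (n := n) hd n (d+1) (by omega) (by omega) _ inferInstance
end inj
end Bass

namespace Bass
open Abelian
section tor
open TensorProduct
variable {R : Type} [CommRing R]

section dual
variable {A B C : Type} [AddCommGroup A] [Module R A] [AddCommGroup B] [Module R B]
  [AddCommGroup C] [Module R C]

lemma dual_exact {f : A →ₗ[R] B} {g : B →ₗ[R] C} (h : Function.Exact f g) :
    Function.Exact (CharacterModule.dual g) (CharacterModule.dual f) := by
  intro L
  constructor
  · intro hL
    have hker : LinearMap.ker g.toAddMonoidHom.toIntLinearMap ≤ LinearMap.ker (AddMonoidHom.toIntLinearMap (L : B →+ AddCircle (1 : ℚ))) := by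
      intro b hb
      obtain ⟨a, rfl⟩ := (h b).mp hb
      exact DFunLike.congr_fun hL a
    let g' : B →ₗ[ℤ] C := g.toAddMonoidHom.toIntLinearMap
    let q := (LinearMap.ker g').liftQ g' le_rfl
    have hq : Function.Injective q := by
      rw [← LinearMap.ker_eq_bot]
      exact Submodule.ker_liftQ_eq_bot _ _ _ le_rfl
    let L' := (LinearMap.ker g').liftQ (AddMonoidHom.toIntLinearMap (L : B →+ AddCircle (1 : ℚ))) hker
    obtain ⟨M, hM⟩ := CharacterModule.dual_surjective_of_injective (R := ℤ) q hq (L'.toAddMonoidHom)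
    refine ⟨M, ?_⟩
    ext b
    exact DFunLike.congr_fun hM (Submodule.Quotient.mk b)
  · rintro ⟨M, rfl⟩
    ext a
    change M (g (f a)) = 0
    rw [(h _).mpr ⟨a, rfl⟩, map_zero]

lemma exact_of_dual {f : A →ₗ[R] B} {g : B →ₗ[R] C}
    (h : Function.Exact (CharacterModule.dual g) (CharacterModule.dual f)) :
    Function.Exact f g := by
  intro b
  constructor
  · intro hb
    change b ∈ LinearMap.range f
    rw [← Submodule.Quotient.mk_eq_zero (LinearMap.range f)]
    refine CharacterModule.eq_zero_of_character_apply fun c => ?_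
    obtain ⟨L, hL⟩ := (h (CharacterModule.dual (LinearMap.range f).mkQ c)).mp (by
      ext a
      change c ((LinearMap.range f).mkQ (f a)) = 0
      rw [Submodule.mkQ_apply, (Submodule.Quotient.mk_eq_zero _).mpr (LinearMap.mem_range_self f a), map_zero])
    have := DFunLike.congr_fun hL b
    change L (g b) = c _ at this
    rw [hb, map_zero] at this
    exact this.symm
  · rintro ⟨a, rfl⟩
    refine CharacterModule.eq_zero_of_character_apply fun c => ?_
    exact DFunLike.congr_fun ((h (CharacterModule.dual g c)).mpr ⟨c, rfl⟩) a

/-- exactness after tensoring, dually -/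
lemma tensor_exact_iff (M : Type) [AddCommGroup M] [Module R M] (f : A →ₗ[R] B) (g : B →ₗ[R] C) :
    Function.Exact (f.lTensor M) (g.lTensor M) ↔
      Function.Exact (fun φ : M →ₗ[R] CharacterModule C => CharacterModule.dual g ∘ₗ φ)
        (fun φ : M →ₗ[R] CharacterModule B => CharacterModule.dual f ∘ₗ φ) := by
  have key : ∀ {X Y : Type} [AddCommGroup X] [Module R X] [AddCommGroup Y] [Module R Y] (u : X →ₗ[R] Y)
      (φ : M →ₗ[R] CharacterModule Y),
      CharacterModule.dual (u.lTensor M) (CharacterModule.homEquiv φ) = CharacterModule.homEquiv (CharacterModule.dual u ∘ₗ φ) := by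
    intro X Y _ _ _ _ u φ
    apply CharacterModule.homEquiv.symm.injective
    rw [LinearEquiv.symm_apply_apply]
    rfl
  have : Function.Exact (f.lTensor M) (g.lTensor M) ↔
    Function.Exact (CharacterModule.dual (g.lTensor M)) (CharacterModule.dual (f.lTensor M)) :=
    ⟨dual_exact, exact_of_dual⟩
  rw [this]
  constructor
  · intro h φ
    have := h (CharacterModule.homEquiv φ)
    rw [key] at this
    rw [← map_eq_zero_iff _ (CharacterModule.homEquiv (R := R)).injective, this]
    constructor
    · rintro ⟨ψ, hψ⟩
      obtain ⟨ψ, rfl⟩ := (CharacterModule.homEquiv (R := R)).surjective ψ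
      rw [key] at hψ
      exact ⟨ψ, CharacterModule.homEquiv.injective hψ⟩
    · rintro ⟨ψ, rfl⟩
      exact ⟨CharacterModule.homEquiv ψ, key _ _⟩
  · intro h φ
    obtain ⟨φ, rfl⟩ := (CharacterModule.homEquiv (R := R)).surjective φ
    rw [key, map_eq_zero_iff _ (CharacterModule.homEquiv (R := R)).injective]
    refine (h φ).trans ?_
    constructor
    · rintro ⟨ψ, rfl⟩
      exact ⟨CharacterModule.homEquiv ψ, key _ _⟩
    · rintro ⟨ψ, hψ⟩
      obtain ⟨ψ, rfl⟩ := (CharacterModule.homEquiv (R := R)).surjective ψ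
      rw [key] at hψ
      exact ⟨ψ, CharacterModule.homEquiv.injective hψ⟩
end dual

abbrev ch (M : ModuleCat.{0} R) : ModuleCat.{0} R := ModuleCat.of R (CharacterModule M)

def chMap {M N : ModuleCat.{0} R} (f : M ⟶ N) : ch N ⟶ ch M := ModuleCat.ofHom (CharacterModule.dual f.hom)

lemma chMap_zero {M N : ModuleCat.{0} R} : chMap (0 : M ⟶ N) = 0 := by
  ext x : 2
  exact DFunLike.congr_fun (CharacterModule.dual_zero (R := R) (A := M) (B := N)) x

lemma chMap_comp {M N K : ModuleCat.{0} R} (f : M ⟶ N) (g : N ⟶ K) : chMap (f ≫ g) = chMap g ≫ chMap f := rfl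

lemma ch_exact {S : ShortComplex (ModuleCat.{0} R)} (hS : S.Exact) (w : chMap S.g ≫ chMap S.f = 0) :
    (ShortComplex.mk (chMap S.g) (chMap S.f) w).Exact := by
  rw [ShortComplex.ShortExact.moduleCat_exact_iff_function_exact] at hS ⊢
  exact dual_exact hS

noncomputable def chComplex (K : ChainComplex (ModuleCat.{0} R) ℕ) : CochainComplex (ModuleCat.{0} R) ℕ where
  X n := ch (K.X n)
  d i j := chMap (K.d j i)
  shape i j h := by rw [K.shape _ _ h, chMap_zero]
  d_comp_d' i j k _ _ := by rw [← chMap_comp, K.d_comp_d, chMap_zero]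

lemma chComplex_exact {K : ChainComplex (ModuleCat.{0} R) ℕ} {n : ℕ} (h : K.ExactAt (n+1)) :
    (chComplex K).ExactAt (n+1) := by
  rw [HomologicalComplex.exactAt_iff' _ n (n + 1) (n + 1 + 1) (by simp) (by simp)]
  rw [HomologicalComplex.exactAt_iff' _ (n+1+1) (n + 1) n (by simp) (by simp)] at h
  exact ch_exact h _

lemma ch_injective (P : ModuleCat.{0} R) [Projective P] : Injective (ch P) := by
  have : Module.Projective R P := (IsProjective.iff_projective (R := R) P).mpr ‹_›
  exact (Module.injective_iff_injective_object R _).mp (Module.Flat.iff_characterModule_injective.mp inferInstance)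

noncomputable def chRes {N : ModuleCat.{0} R} (P : ProjectiveResolution N) : InjectiveResolution (ch N) where
  cocomplex := chComplex P.complex
  injective n := ch_injective _
  ι := (CochainComplex.fromSingle₀Equiv _ _).symm ⟨chMap (ChainComplex.toSingle₀Equiv _ _ P.π).1, by
    change _ ≫ chMap _ = 0
    rw [← chMap_comp, (ChainComplex.toSingle₀Equiv _ _ P.π).2, chMap_zero]⟩
  quasiIso := ⟨fun n => by
    cases n
    · rw [CochainComplex.quasiIsoAt₀_iff, ShortComplex.quasiIso_iff_of_zeros]
      · refine (ShortComplex.exact_and_mono_f_iff_of_iso ?_).2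
          ⟨ch_exact P.exact₀ (by rw [← chMap_comp, ShortComplex.zero, chMap_zero]), (ModuleCat.mono_iff_injective _).mpr
              (CharacterModule.dual_injective_of_surjective _ ((ModuleCat.epi_iff_surjective (P.π.f 0)).mp inferInstance))⟩
        exact ShortComplex.isoMk (Iso.refl _) (Iso.refl _) (Iso.refl _) (by
            refine (Category.id_comp _).trans (Eq.trans ?_ (Category.comp_id _).symm)
            exact (CochainComplex.fromSingle₀Equiv_symm_apply_f_zero (C := chComplex P.complex) (X := ch N) (chMap (ChainComplex.toSingle₀Equiv _ _ P.π).1) _).symm)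
          (by exact (Category.id_comp _).trans (Category.comp_id _).symm)
      all_goals first | rfl | exact (chComplex P.complex).shape _ _ (by simp)
    · rw [quasiIsoAt_iff_exactAt]
      · apply chComplex_exact (P.complex_exactAt_succ _)
      · apply CochainComplex.exactAt_succ_single_obj⟩

lemma tor_iff (A N : ModuleCat.{0} R) (i : ℕ) :
    Subsingleton (((_root_.CategoryTheory.Tor (ModuleCat.{0} R) (i+1)).obj A).obj N) ↔
      Subsingleton (Abelian.Ext A (ch N) (i+1)) := by
  let P := projectiveResolution N
  have h1 : Subsingleton (((_root_.CategoryTheory.Tor (ModuleCat.{0} R) (i+1)).obj A).obj N) ↔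
      Function.Exact ((P.complex.d (i+2) (i+1)).hom.lTensor A) ((P.complex.d (i+1) i).hom.lTensor A) := by
    rw [← ModuleCat.isZero_iff_subsingleton]
    refine (P.isoLeftDerivedObj ((MonoidalCategory.tensoringLeft (ModuleCat.{0} R)).obj A) (i+1)).isZero_iff.trans ?_
    refine (HomologicalComplex.exactAt_iff_isZero_homology _ _).symm.trans ?_
    rw [
      HomologicalComplex.exactAt_iff' _ (i+2) (i+1) i (by simp) (by simp),
      ShortComplex.ShortExact.moduleCat_exact_iff_function_exact]
    rfl
  rw [h1, tensor_exact_iff]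
  let Q := chRes P
  constructor
  · intro h
    refine subsingleton_of_forall_eq 0 fun e => ?_
    obtain ⟨f, hf, rfl⟩ := Q.extMk_surjective e (i+2) rfl
    refine (Q.extMk_eq_zero_iff f _ _ hf i rfl).mpr ?_
    obtain ⟨g, hg⟩ := (h f.hom).mp congr(($hf).hom)
    exact ⟨ModuleCat.ofHom g, ModuleCat.hom_ext hg⟩
  · intro h f
    constructor
    · intro hf
      obtain ⟨g, hg⟩ := (Q.extMk_eq_zero_iff (ModuleCat.ofHom f) (i+2) rfl (ModuleCat.hom_ext hf) i rfl).mp (Subsingleton.elim _ _)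
      exact ⟨g.hom, congr(($hg).hom)⟩
    · rintro ⟨g, rfl⟩
      ext x : 1
      have : P.complex.d (i+2) (i+1) ≫ P.complex.d (i+1) i = 0 := P.complex.d_comp_d _ _ _
      change (chMap (P.complex.d (i+1) i) ≫ chMap (P.complex.d (i+2) (i+1))) (g x) = 0
      rw [← chMap_comp, this, chMap_zero]
      rfl

lemma flatDimLE_iff (N : Type) [AddCommGroup N] [Module R N] (n : ℕ) :
    flatDimLE R N n ↔ HasInjectiveDimensionLT (ch (ModuleCat.of R N)) (n+1) := by
  constructor
  · intro h
    refine HasInjectiveDimensionLT.mk fun i hi A e => ?_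
    obtain ⟨i, rfl⟩ : ∃ l, i = l + 1 := ⟨i - 1, by omega⟩
    exact ((tor_iff _ _ _).mp (h A (i+1) hi)).elim _ _
  · intro h A i hi
    obtain ⟨i, rfl⟩ : ∃ l, i = l + 1 := ⟨i - 1, by omega⟩
    exact (tor_iff _ _ _).mpr (HasInjectiveDimensionLT.subsingleton _ (n+1) _ hi _)
end tor
end Bass

/-- Over a `d`-dimensional Noetherian local ring, a module of finite injective (resp. flat)
dimension has injective (resp. flat) dimension at most `d`. -/
theorem stmt_9 (R : Type) [CommRing R] [IsNoetherianRing R] [IsLocalRing R]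
    (d : ℕ) (hd : ringKrullDim R = d)
    (N : Type) [AddCommGroup N] [Module R N] :
    ((∃ n, injDimLE R N n) → injDimLE R N d) ∧
      ((∃ n, flatDimLE R N n) → flatDimLE R N d) := by
  constructor
  · rintro ⟨n, h⟩
    rw [Bass.injDimLE_iff] at h ⊢
    exact Bass.bound (n := n+1) hd
  · rintro ⟨n, h⟩
    rw [Bass.flatDimLE_iff] at h ⊢
    exact Bass.bound (n := n+1) hd
end

section
/- Let (R, m, k) be a commutative Noetherian local ring of prime characteristic p, let M ≠ 0 be a finitely generated Cohen-Macaulay R-module with residue field k infinite. Then there exists a system of parameters x₁,…,x_t on M (t = dim M) such that m^{[p^e]} M ⊆ (x₁,…,x_t)M whenever p^e ≥ e_R(M), where e_R(M) is the Hilbert–Samuel multiplicity of M; in other words drs_p(M) ≤ ⌈log_p e_R(M)⌉. -/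
open IsLocalRing

/-- The length of a module, as the Krull dimension of its lattice of submodules. -/
noncomputable def moduleLength (R M : Type) [CommRing R] [AddCommGroup M] [Module R M] :
    WithBot ℕ∞ :=
  Order.krullDim (Submodule R M)


lemma aux_avoid {R : Type} [CommRing R] [IsLocalRing R] (hk : Infinite (ResidueField R))
    {X : Type} [AddCommGroup X] [Module R X] (S : Finset (Submodule R X)) (hS : ⊤ ∉ S) :
    ∃ x : X, ∀ p ∈ S, x ∉ p := by
  by_contra! h
  have hc : ⋃ i ∈ S, ((id i : Submodule R X) : Set X) = Set.univ := by
    ext x; simpa using h x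
  obtain ⟨p, hp, hfi⟩ := Submodule.exists_finiteIndex_of_cover hc
  have hfi' : p.toAddSubgroup.FiniteIndex := hfi
  have hfin : Finite (X ⧸ p) := AddSubgroup.finite_quotient_of_finiteIndex (H := p.toAddSubgroup)
  have : Nontrivial (X ⧸ p) :=
    Submodule.Quotient.nontrivial_iff.mpr (ne_of_mem_of_not_mem hp hS)
  obtain ⟨v, hv⟩ := exists_ne (0 : X ⧸ p)
  let f := LinearMap.toSpanSingleton R (X ⧸ p) v
  have hf : LinearMap.ker f ≤ maximalIdeal R := by
    apply IsLocalRing.le_maximalIdeal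
    intro h
    have : (1 : R) ∈ LinearMap.ker f := by rw [h]; trivial
    apply hv
    simpa [f] using this
  have h1 : Finite (R ⧸ LinearMap.ker f) :=
    Finite.of_injective _ (LinearMap.ker_eq_bot.mp (Submodule.ker_liftQ_eq_bot _ f le_rfl le_rfl))
  have h2 : Finite (R ⧸ maximalIdeal R) := Finite.of_surjective _ (Submodule.factor_surjective hf)
  exact hk.not_finite h2

lemma aux_abs {R : Type} [CommRing R] [IsLocalRing R] (hk : Infinite (ResidueField R))
    {X : Type} [AddCommGroup X] [Module R X] {A : Type} [CommRing A] [Algebra R A]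
    [IsNoetherianRing A] (ι : X →ₗ[R] A) {N : Type} [AddCommGroup N] [Module A N]
    [Module.Finite A N] (N' : Submodule A N) (T : Finset (Submodule R X)) (hT : ⊤ ∉ T) :
    ∃ x : X, (∀ p ∈ T, x ∉ p) ∧ ∃ j : ℕ,
      ∀ g ∈ ((Ideal.span (Set.range ι)) ^ j • ⊤ : Submodule A N), ι x • g ∈ N' → g ∈ N' := by
  classical
  let G := N ⧸ N'
  let J : Ideal A := Ideal.span (Set.range ι)
  let V : Ideal A → Submodule R X := fun P => (P.restrictScalars R).comap ι
  have hfinG := associatedPrimes.finite A G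
  let S : Finset (Submodule R X) := (hfinG.toFinset.image V).erase ⊤ ∪ T
  have hS : ⊤ ∉ S := by simpa [S] using hT
  obtain ⟨x, hx⟩ := aux_avoid hk S hS
  refine ⟨x, fun p hp => hx p (Finset.mem_union_right _ hp), ?_⟩
  let K : Submodule A G := LinearMap.ker (LinearMap.lsmul A G (ι x))
  have hKann : ι x ∈ Module.annihilator A K := by
    rw [Module.mem_annihilator]
    intro g
    ext1
    exact g.2
  have hJP : ∀ P ∈ (Module.annihilator A K).minimalPrimes, J ≤ P := by
    intro P hP
    have h1 := Module.associatedPrimes.minimalPrimes_annihilator_subset_associatedPrimes A K hP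
    have h2 := associatedPrimes.subset_of_injective K.injective_subtype h1
    have h3 : x ∈ V P := hP.1.2 hKann
    have h4 : V P = ⊤ := by
      by_contra h4
      refine hx (V P) ?_ h3
      simp only [S, Finset.mem_union, Finset.mem_erase, Finset.mem_image,
        Set.Finite.mem_toFinset]
      exact Or.inl ⟨h4, P, h2, rfl⟩
    refine Ideal.span_le.mpr ?_
    rintro _ ⟨b, rfl⟩
    have : b ∈ V P := by rw [h4]; trivial
    exact this
  have hrad : J ≤ (Module.annihilator A K).radical := by
    rw [← Ideal.sInf_minimalPrimes]
    exact le_sInf hJP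
  obtain ⟨c, hc⟩ := Ideal.exists_pow_le_of_le_radical_of_fg hrad (IsNoetherian.noetherian J)
  obtain ⟨k, hk'⟩ := Ideal.exists_pow_inf_eq_pow_smul J K
  refine ⟨k + c, fun g hg hxg => ?_⟩
  have hgG : N'.mkQ g ∈ (J ^ (k + c) • ⊤ : Submodule A G) := by
    have := Submodule.mem_map_of_mem (f := N'.mkQ) hg
    rw [Submodule.map_smul''] at this
    exact Submodule.smul_mono le_rfl le_top this
  have hgK : N'.mkQ g ∈ K := by
    change ι x • N'.mkQ g = 0
    rw [← map_smul, Submodule.mkQ_apply, Submodule.Quotient.mk_eq_zero]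
    exact hxg
  have h1 : N'.mkQ g ∈ (J ^ (k + c) • ⊤ ⊓ K : Submodule A G) := ⟨hgG, hgK⟩
  rw [hk' _ (by omega)] at h1
  have h2 := Submodule.smul_mono (show J ^ (k + c - k) ≤ Module.annihilator A K by
    rwa [Nat.add_sub_cancel_left]) (inf_le_right (a := (J ^ k • ⊤ : Submodule A G)) (b := K)) h1
  have h3 : Module.annihilator A K • K = ⊥ := Submodule.annihilator_smul K
  rw [h3] at h2
  have h0 : N'.mkQ g = 0 := (Submodule.mem_bot A).mp h2
  rwa [Submodule.mkQ_apply, Submodule.Quotient.mk_eq_zero] at h0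

lemma aux_superficial_gr {R : Type} [CommRing R] [IsNoetherianRing R] [IsLocalRing R]
    (hk : Infinite (ResidueField R))
    (M : Type) [AddCommGroup M] [Module R M] [Module.Finite R M]
    (a : R) (ha : a ∈ maximalIdeal R) (hreg : IsSMulRegular M a) :
    ∃ x ∈ maximalIdeal R, IsSMulRegular M x ∧ ∃ j : ℕ, ∀ n ≥ j, ∀ z : M,
      z ∈ (maximalIdeal R ^ n • ⊤ : Submodule R M) →
      x • z ∈ (maximalIdeal R ^ (n + 2) • ⊤ : Submodule R M) →
      z ∈ (maximalIdeal R ^ (n + 1) • ⊤ : Submodule R M) := by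
  classical
  set m := maximalIdeal R with hm
  let F : m.Filtration M := m.stableFiltration ⊤
  let F' : m.Filtration M :=
    { N := fun i => m ^ (i + 1) • ⊤
      mono := fun i => Submodule.smul_mono_left (Ideal.pow_le_pow_right (by omega))
      smul_le := fun i => by rw [← Submodule.mul_smul, ← pow_succ'] }
  let A := reesAlgebra m
  let NN : Submodule A (PolynomialModule R M) := F.submodule
  have hfg : NN.FG := (F.submodule_fg_iff_stable fun i => IsNoetherian.noetherian _).mpr
    (m.stableFiltration_stable ⊤)
  have : Module.Finite A NN := Module.Finite.iff_fg.mpr hfg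
  let N' : Submodule A NN := F'.submodule.comap NN.subtype
  let ι : m →ₗ[R] A :=
    { toFun := fun b => ⟨Polynomial.monomial 1 (b : R),
        reesAlgebra.monomial_mem.mpr (by simp)⟩
      map_add' := fun b c => by ext1; simp
      map_smul' := fun r b => by ext1; simp [Polynomial.smul_monomial] }
  let J : Ideal A := Ideal.span (Set.range ι)
  have hJ : ∀ i n (z : M), z ∈ (m ^ (i + n) • ⊤ : Submodule R M) →
      ∃ g ∈ (J ^ i • ⊤ : Submodule A NN), (g : PolynomialModule R M) =
        PolynomialModule.single R (i + n) z := by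
    intro i
    induction i with
    | zero =>
      intro n z hz
      refine ⟨⟨PolynomialModule.single R (0 + n) z, ?_⟩, by simp, rfl⟩
      rw [Ideal.Filtration.mem_submodule]
      intro k
      rw [PolynomialModule.coeff_single, Finsupp.single_apply]
      split_ifs with h
      · subst h; exact hz
      · exact zero_mem _
    | succ i ih =>
      intro n z hz
      rw [show i + 1 + n = (i + n) + 1 by ring, pow_succ', Submodule.mul_smul] at hz
      induction hz using Submodule.smul_induction_on' with
      | smul b hb y hy =>
        obtain ⟨g, hg, hg'⟩ := ih n y hy
        refine ⟨ι ⟨b, hb⟩ • g, ?_, ?_⟩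
        · rw [pow_succ', Submodule.mul_smul]
          exact Submodule.smul_mem_smul (Ideal.subset_span ⟨_, rfl⟩) hg
        · rw [Submodule.coe_smul, hg']
          refine (PolynomialModule.monomial_smul_single 1 b (i + n) y).trans ?_
          congr 1; ring
      | add y hy z hz h1 h2 =>
        obtain ⟨g, hg, hg'⟩ := h1
        obtain ⟨g2, hg2, hg2'⟩ := h2
        exact ⟨g + g2, add_mem hg hg2, by simp [hg', hg2', PolynomialModule.single_add]⟩
  have hfinM := associatedPrimes.finite R M
  let S : Finset (Submodule R m) :=
    hfinM.toFinset.image (fun Q => Submodule.comap m.subtype Q)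
  have hzd := biUnion_associatedPrimes_eq_zero_divisors R M
  have hS : ⊤ ∉ S := by
    intro h
    simp only [S, Finset.mem_image, Set.Finite.mem_toFinset] at h
    obtain ⟨Q, hQ, hQ'⟩ := h
    have : (⟨a, ha⟩ : m) ∈ Submodule.comap m.subtype Q := by rw [hQ']; trivial
    have : a ∈ ⋃ p ∈ associatedPrimes R M, (p : Set R) := by
      simp only [Set.mem_iUnion]; exact ⟨Q, hQ, this⟩
    rw [hzd] at this
    obtain ⟨y, hy, hy'⟩ := this
    exact hy (hreg (by simpa using hy'))
  obtain ⟨x, hx, j, hj⟩ := aux_abs (N := NN) hk ι N' S hS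
  refine ⟨x, x.2, ?_, j, ?_⟩
  · rw [isSMulRegular_iff_right_eq_zero_of_smul]
    intro y hy
    by_contra hy0
    have : (x : R) ∈ ⋃ p ∈ associatedPrimes R M, (p : Set R) := by
      rw [hzd]; exact ⟨y, hy0, hy⟩
    simp only [Set.mem_iUnion] at this
    obtain ⟨Q, hQ, hQ'⟩ := this
    refine hx (Submodule.comap m.subtype Q) ?_ hQ'
    simp only [S, Finset.mem_image, Set.Finite.mem_toFinset]
    exact ⟨Q, hQ, rfl⟩
  · intro n hn z hz hxz
    obtain ⟨n, rfl⟩ := Nat.exists_eq_add_of_le hn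
    obtain ⟨g, hg, hg'⟩ := hJ j n z hz
    have h5 : (g : PolynomialModule R M) ∈ F'.submodule := by
      refine hj g hg ?_
      change ((ι x • g : NN) : PolynomialModule R M) ∈ F'.submodule
      rw [Submodule.coe_smul, hg']
      have := PolynomialModule.monomial_smul_single 1 (x : R) (j + n) z
      have e : ι x • PolynomialModule.single R (j + n) z =
        PolynomialModule.single R (1 + (j + n)) ((x : R) • z) := this
      rw [e, Ideal.Filtration.mem_submodule]
      intro l
      rw [PolynomialModule.coeff_single, Finsupp.single_apply]
      split_ifs with h
      · subst h
        change _ ∈ (m ^ (1 + (j + n) + 1) • ⊤ : Submodule R M)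
        rwa [show 1 + (j + n) + 1 = j + n + 2 by ring]
      · exact zero_mem _
    rw [hg', Ideal.Filtration.mem_submodule] at h5
    have := h5 (j + n)
    rw [PolynomialModule.coeff_single, Finsupp.single_eq_same] at this
    exact this

lemma aux_superficial {R : Type} [CommRing R] [IsNoetherianRing R] [IsLocalRing R]
    (hk : Infinite (ResidueField R))
    (M : Type) [AddCommGroup M] [Module R M] [Module.Finite R M]
    (a : R) (ha : a ∈ maximalIdeal R) (hreg : IsSMulRegular M a) :
    ∃ x ∈ maximalIdeal R, IsSMulRegular M x ∧ ∃ j : ℕ, ∀ n ≥ j, ∀ z : M,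
      x • z ∈ (maximalIdeal R ^ (n + 1) • ⊤ : Submodule R M) →
      z ∈ (maximalIdeal R ^ n • ⊤ : Submodule R M) := by
  obtain ⟨x, hx, hxr, j, hj⟩ := aux_superficial_gr hk M a ha hreg
  obtain ⟨k, hk'⟩ := Ideal.exists_pow_inf_eq_pow_smul (maximalIdeal R)
    (LinearMap.range (LinearMap.lsmul R M x))
  refine ⟨x, hx, hxr, j + k, fun n hn z hz => ?_⟩
  have hmono : ∀ a b : ℕ, a ≤ b → (maximalIdeal R ^ b • ⊤ : Submodule R M) ≤
      maximalIdeal R ^ a • ⊤ := fun a b h => Submodule.smul_mono_left (Ideal.pow_le_pow_right h)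
  have h1 : z ∈ (maximalIdeal R ^ (n + 1 - k) • ⊤ : Submodule R M) := by
    have h2 : x • z ∈ (maximalIdeal R ^ (n + 1) • ⊤ ⊓ LinearMap.range (LinearMap.lsmul R M x) :
      Submodule R M) := ⟨hz, ⟨z, rfl⟩⟩
    rw [hk' _ (by omega)] at h2
    have h3 := Submodule.smul_mono (le_refl (maximalIdeal R ^ (n + 1 - k)))
      (inf_le_right (b := LinearMap.range (LinearMap.lsmul R M x))) h2
    rw [LinearMap.range_eq_map, ← Submodule.map_smul''] at h3
    obtain ⟨w, hw, hw'⟩ := h3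
    have : w = z := hxr hw'
    rwa [← this]
  have h2 : ∀ i, j + i ≤ n → z ∈ (maximalIdeal R ^ (j + i) • ⊤ : Submodule R M) := by
    intro i
    induction i with
    | zero => intro _; exact hmono _ _ (by omega) h1
    | succ i ih =>
      intro hi
      exact hj (j + i) (by omega) z (ih (by omega)) (hmono _ _ (by omega) hz)
  have := h2 (n - j) (by omega)
  rwa [show j + (n - j) = n by omega] at this

open Pointwise in
lemma aux_length {R : Type} [CommRing R] (I : Ideal R)
    (M : Type) [AddCommGroup M] [Module R M] (x : R) (n : ℕ)
    (h : ∀ z : M, x • z ∈ (I ^ (n + 1) • ⊤ : Submodule R M) →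
      z ∈ (I ^ n • ⊤ : Submodule R M)) :
    Module.length R (M ⧸ (I ^ n • ⊤ : Submodule R M)) +
      Module.length R (QuotSMulTop x M ⧸ (I ^ (n + 1) • ⊤ : Submodule R (QuotSMulTop x M))) ≤
      Module.length R (M ⧸ (I ^ (n + 1) • ⊤ : Submodule R M)) := by
  let Q := M ⧸ (I ^ (n + 1) • ⊤ : Submodule R M)
  let g : M →ₗ[R] Q := (Submodule.mkQ _) ∘ₗ LinearMap.lsmul R M x
  have hker : LinearMap.ker g ≤ (I ^ n • ⊤ : Submodule R M) := by
    intro z hz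
    apply h
    have : Submodule.mkQ (I ^ (n + 1) • ⊤ : Submodule R M) (x • z) = 0 := hz
    rwa [Submodule.mkQ_apply, Submodule.Quotient.mk_eq_zero] at this
  rw [Module.length_eq_add_of_exact (LinearMap.range g).subtype (LinearMap.range g).mkQ
    (Submodule.subtype_injective _) (Submodule.mkQ_surjective _)
    (LinearMap.exact_subtype_mkQ _)]
  refine add_le_add ?_ ?_
  · rw [← g.quotKerEquivRange.length_eq]
    exact Module.length_le_of_surjective (Submodule.factor hker)
      (Submodule.factor_surjective hker)
  · let f0 : Q →ₗ[R] (QuotSMulTop x M ⧸ (I ^ (n + 1) • ⊤ : Submodule R (QuotSMulTop x M))) :=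
      Submodule.mapQ _ _ (Submodule.mkQ _) (Submodule.smul_top_le_comap_smul_top _ _)
    have hf0 : Function.Surjective f0 := by
      intro y
      obtain ⟨y, rfl⟩ := Submodule.mkQ_surjective _ y
      obtain ⟨y, rfl⟩ := Submodule.mkQ_surjective _ y
      exact ⟨Submodule.mkQ _ y, rfl⟩
    have hle : LinearMap.range g ≤ LinearMap.ker f0 := by
      rintro _ ⟨z, rfl⟩
      change Submodule.mkQ _ (Submodule.mkQ _ (x • z)) = 0
      have : Submodule.mkQ (x • ⊤ : Submodule R M) (x • z) = 0 := by
        rw [Submodule.mkQ_apply, Submodule.Quotient.mk_eq_zero]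
        exact Submodule.smul_mem_pointwise_smul _ _ _ Submodule.mem_top
      rw [this, map_zero]
    refine Module.length_le_of_surjective ((LinearMap.range g).liftQ f0 hle) ?_
    intro y
    obtain ⟨w, rfl⟩ := hf0 y
    exact ⟨Submodule.mkQ _ w, rfl⟩

open CategoryTheory Abelian RingTheory.Sequence in
lemma aux_depth {R : Type} [CommRing R] [IsNoetherianRing R] [IsLocalRing R]
    (M : Type) [AddCommGroup M] [Module R M] [Module.Finite R M] [Nontrivial M] (t : ℕ)
    (h : ∃ rs : List R, rs.length = t + 1 ∧ (∀ r ∈ rs, r ∈ maximalIdeal R) ∧ IsRegular M rs)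
    (x : R) (hx : x ∈ maximalIdeal R) (hxr : IsSMulRegular M x) :
    ∃ rs : List R, rs.length = t ∧ (∀ r ∈ rs, r ∈ maximalIdeal R) ∧
      IsRegular (QuotSMulTop x M) rs := by
  have lt : ∀ (N : Type) [AddCommGroup N] [Module R N] [Module.Finite R N] [Nontrivial N],
      maximalIdeal R • (⊤ : Submodule R N) < ⊤ := by
    intro N _ _ _ _
    exact (Submodule.top_ne_ideal_smul_of_le_jacobson_annihilator
      (maximalIdeal_le_jacobson _)).symm.lt_top
  have := nontrivial_quotSMulTop_of_mem_maximalIdeal M hx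
  have h2 := ((ModuleCat.exists_isRegular_tfae (maximalIdeal R) (t + 1) (ModuleCat.of R M)
    (lt M)).out 3 1).mp h
  refine ((ModuleCat.exists_isRegular_tfae (maximalIdeal R) t
    (ModuleCat.of R (QuotSMulTop x M)) (lt (QuotSMulTop x M))).out 1 3).mp ?_
  intro i hi
  have zero1 := AddCommGrpCat.isZero_of_iff_subsingleton.mpr (h2 i (by omega))
  have zero2 := AddCommGrpCat.isZero_of_iff_subsingleton.mpr (h2 (i + 1) (by omega))
  have hxr' : IsSMulRegular (ModuleCat.of R M) x := hxr
  exact AddCommGrpCat.subsingleton_of_isZero <| ShortComplex.Exact.isZero_of_both_zeros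
    ((Ext.covariant_sequence_exact₃' _ hxr'.smulShortComplex_shortExact) i (i + 1) rfl)
    (zero1.eq_zero_of_src _) (zero2.eq_zero_of_tgt _)

lemma aux_base {R : Type} [CommRing R] [IsNoetherianRing R] [IsLocalRing R]
    (M : Type) [AddCommGroup M] [Module R M] [Module.Finite R M]
    (hdim : Module.supportDim R M = 0) :
    IsArtinian R M ∧ ∃ c : ℕ, ∀ n, (maximalIdeal R ^ (c + n) • ⊤ : Submodule R M) = ⊥ := by
  have hA : IsArtinian R M := by
    rw [Module.supportDim_eq_ringKrullDim_quotient_annihilator] at hdim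
    have : Ring.KrullDimLE 0 (R ⧸ Module.annihilator R M) := by
      rw [Ring.krullDimLE_iff]; simp [hdim]
    have : IsArtinianRing (R ⧸ Module.annihilator R M) :=
      isArtinianRing_iff_isNoetherianRing_krullDimLE_zero.mpr ⟨inferInstance, this⟩
    let _ := Module.quotientAnnihilator (R := R) (M := M)
    have : IsScalarTower R (R ⧸ Module.annihilator R M) M := inferInstance
    have : Module.Finite (R ⧸ Module.annihilator R M) M :=
      Module.Finite.of_restrictScalars_finite R _ _
    have : IsArtinian (R ⧸ Module.annihilator R M) M := inferInstance
    exact isArtinian_of_surjective_algebraMap (R := R ⧸ Module.annihilator R M)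
      Ideal.Quotient.mk_surjective
  refine ⟨hA, ?_⟩
  obtain ⟨c, hc⟩ := IsArtinian.monotone_stabilizes (R := R) (M := M)
    ⟨fun n => OrderDual.toDual (maximalIdeal R ^ n • ⊤ : Submodule R M), fun a b h =>
      Submodule.smul_mono_left (Ideal.pow_le_pow_right h)⟩
  have h1 : (maximalIdeal R ^ c • ⊤ : Submodule R M) = maximalIdeal R ^ (c + 1) • ⊤ :=
    hc (c + 1) (by omega)
  have h2 : (maximalIdeal R ^ c • ⊤ : Submodule R M) = ⊥ := by
    apply Submodule.eq_bot_of_le_smul_of_le_jacobson_bot (maximalIdeal R) _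
      (IsNoetherian.noetherian _)
    · rw [← Submodule.mul_smul, ← pow_succ', ← h1]
    · exact maximalIdeal_le_jacobson _
  refine ⟨c, fun n => ?_⟩
  have : (maximalIdeal R ^ c • ⊤ : Submodule R M) = maximalIdeal R ^ (c + n) • ⊤ :=
    hc (c + n) (by omega)
  rw [← this, h2]

lemma aux_main {R : Type} [CommRing R] [IsNoetherianRing R] [IsLocalRing R]
    (hk : Infinite (ResidueField R)) (t : ℕ) :
    ∀ (M : Type) [AddCommGroup M] [Module R M] [Module.Finite R M] [Nontrivial M]
    (_ : Module.supportDim R M = t)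
    (_ : ∃ rs : List R, rs.length = t ∧ (∀ r ∈ rs, r ∈ maximalIdeal R) ∧
      RingTheory.Sequence.IsRegular M rs),
    ∃ xs : List R, xs.length = t ∧ (∀ r ∈ xs, r ∈ maximalIdeal R) ∧
      IsFiniteLength R (M ⧸ (Ideal.ofList xs • ⊤ : Submodule R M)) ∧
      ∃ c : ℕ, ∀ n : ℕ, Module.length R (M ⧸ (Ideal.ofList xs • ⊤ : Submodule R M)) *
        ((n + t).choose t : ℕ) ≤
        Module.length R (M ⧸ (maximalIdeal R ^ (c + n) • ⊤ : Submodule R M)) := by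
  induction t with
  | zero =>
    intro M _ _ _ _ hdim _
    obtain ⟨hA, c, hc⟩ := aux_base M (by simpa using hdim)
    refine ⟨[], rfl, by simp, ?_, c, fun n => ?_⟩
    · rw [isFiniteLength_iff_isNoetherian_isArtinian]
      exact ⟨inferInstance, inferInstance⟩
    · have h : (Ideal.ofList ([] : List R) • ⊤ : Submodule R M) = maximalIdeal R ^ (c + n) • ⊤ := by
        rw [hc n]; simp
      rw [h]; simp
  | succ t ih =>
    intro M _ _ _ _ hdim hreg
    obtain ⟨a, ha, har⟩ : ∃ a ∈ maximalIdeal R, IsSMulRegular M a := by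
      obtain ⟨rs, hl, hm, hr⟩ := hreg
      match rs with
      | [] => simp at hl
      | a :: rs =>
        exact ⟨a, hm a (by simp), ((RingTheory.Sequence.isRegular_cons_iff M a rs).mp hr).1⟩
    obtain ⟨x, hx, hxr, j, hj⟩ := aux_superficial hk M a ha har
    have := nontrivial_quotSMulTop_of_mem_maximalIdeal M hx
    have hd : Module.supportDim R (QuotSMulTop x M) = t := by
      have h := Module.supportDim_quotSMulTop_succ_eq_supportDim hxr hx
      rw [hdim] at h
      push_cast at h
      generalize Module.supportDim R (QuotSMulTop x M) = d at h
      induction d using WithBot.recBotCoe with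
      | bot => simp at h; exact absurd h (by exact_mod_cast WithBot.bot_ne_coe)
      | coe d =>
        norm_cast at h ⊢
        have : d + 1 = ((t : ℕ∞) + 1) := by exact_mod_cast h
        exact (ENat.add_left_injective_of_ne_top (by simp)) this
    obtain ⟨xs, hl, hm, hfin, c, hc⟩ := ih (QuotSMulTop x M) hd (aux_depth M t hreg x hx hxr)
    let e := Submodule.quotOfListConsSMulTopEquivQuotSMulTopInner M x xs
    refine ⟨x :: xs, by simp [hl], by simpa using ⟨hx, hm⟩, ?_, c + j, ?_⟩
    · rw [← Module.length_ne_top_iff] at hfin ⊢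
      rwa [e.length_eq]
    · rw [e.length_eq]
      have hmono : ∀ a b : ℕ, a ≤ b →
          Module.length R (QuotSMulTop x M ⧸ (maximalIdeal R ^ a • ⊤ : Submodule R (QuotSMulTop x M))) ≤
          Module.length R (QuotSMulTop x M ⧸ (maximalIdeal R ^ b • ⊤ : Submodule R (QuotSMulTop x M))) := by
        intro a b h
        have hle : (maximalIdeal R ^ b • ⊤ : Submodule R (QuotSMulTop x M)) ≤
          maximalIdeal R ^ a • ⊤ := Submodule.smul_mono_left (Ideal.pow_le_pow_right h)
        exact Module.length_le_of_surjective (Submodule.factor hle)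
          (Submodule.factor_surjective hle)
      intro n
      induction n with
      | zero =>
        have h1 := aux_length (maximalIdeal R) M x (c + j) (hj _ (by omega))
        have h2 := (hc 0).trans (hmono _ (c + j) (by omega))
        have hs : Function.Surjective (Submodule.mapQ (maximalIdeal R ^ (c + j) • ⊤ : Submodule R M)
            (maximalIdeal R ^ (c + j) • ⊤ : Submodule R (QuotSMulTop x M)) (Submodule.mkQ _)
            (Submodule.smul_top_le_comap_smul_top _ _)) := by
          intro y
          obtain ⟨y, rfl⟩ := Submodule.mkQ_surjective _ y
          obtain ⟨y, rfl⟩ := Submodule.mkQ_surjective _ y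
          exact ⟨Submodule.mkQ _ y, rfl⟩
        have h3 := h2.trans (Module.length_le_of_surjective _ hs)
        simpa using h3
      | succ n ihn =>
        have h1 := aux_length (maximalIdeal R) M x (c + j + n) (hj _ (by omega))
        have h2 := (hc (n + 1)).trans (hmono _ (c + j + n + 1) (by omega))
        refine le_trans ?_ h1
        refine le_trans (le_of_eq ?_) (add_le_add ihn h2)
        rw [← mul_add]
        congr 1
        rw [show n + 1 + (t + 1) = (n + t + 1) + 1 by ring, Nat.choose_succ_succ,
          show n + (t + 1) = n + t + 1 by ring, show n + 1 + t = n + t + 1 by ring]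
        push_cast
        rw [add_comm]

lemma aux_nil {R : Type} [CommRing R] [IsLocalRing R] (r : R)
    (hr : r ∈ maximalIdeal R) (k : ℕ) :
    ∀ (N : Type) [AddCommGroup N] [Module R N], Module.length R N ≤ k →
      ∀ y : N, r ^ k • y = 0 := by
  induction k with
  | zero =>
    intro N _ _ h y
    have : Subsingleton N := Module.length_eq_zero_iff.mp (by simpa using h)
    exact Subsingleton.elim _ _
  | succ k ih =>
    intro N _ _ h y
    have hfin : IsFiniteLength R N := Module.length_ne_top_iff.mp
      (ne_top_of_le_ne_top (ENat.natCast_ne_top _) h)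
    obtain ⟨h1, h2⟩ := isFiniteLength_iff_isNoetherian_isArtinian.mp hfin
    rcases subsingleton_or_nontrivial N with hN | hN
    · exact Subsingleton.elim _ _
    let P := LinearMap.range (LinearMap.lsmul R N r)
    have hP : P ≠ ⊤ := by
      intro hP
      have h3 : (⊤ : Submodule R N) = ⊥ := by
        apply Submodule.eq_bot_of_le_smul_of_le_jacobson_bot (maximalIdeal R) _
          (IsNoetherian.noetherian _)
        · rw [← hP]
          rintro _ ⟨z, rfl⟩
          exact Submodule.smul_mem_smul hr (by rw [hP]; trivial)
        · exact maximalIdeal_le_jacobson _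
      exact top_ne_bot h3
    have h4 := (Submodule.length_lt hP).trans_le h
    have h5 : Module.length R P ≤ k := by
      push_cast at h4
      exact Order.le_of_lt_add_one h4
    have h6 := ih P h5 ⟨r • y, ⟨y, rfl⟩⟩
    have h7 : r ^ k • (r • y) = 0 := congrArg Subtype.val h6
    rwa [smul_smul, ← pow_succ] at h7

/-- Over a Noetherian local ring of prime characteristic `p` with infinite residue field,
a nonzero finitely generated Cohen-Macaulay module `M` of dimension `t` admits a system of
parameters `x₁, …, x_t` such that `m^{[p^e]} M ⊆ (x₁,…,x_t)M` whenever `p^e ≥ e_R(M)`;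
that is, `drs_p(M) ≤ ⌈log_p e_R(M)⌉`. Here the Hilbert–Samuel multiplicity `e_R(M) = μ` is
specified by the limit `t! · ℓ(M/mⁿM)/nᵗ → μ`. -/
theorem stmt_13 (R : Type) [CommRing R] [IsNoetherianRing R] [IsLocalRing R]
    (p : ℕ) [Fact p.Prime] [CharP R p] (hk : Infinite (ResidueField R))
    (M : Type) [AddCommGroup M] [Module R M] [Module.Finite R M] [Nontrivial M]
    (t : ℕ) (hdim : ringKrullDim (R ⧸ Module.annihilator R M) = t)
    (hCM : ∃ rs : List R, rs.length = t ∧ (∀ r ∈ rs, r ∈ maximalIdeal R) ∧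
      RingTheory.Sequence.IsRegular M rs)
    (L : ℕ → ℕ)
    (hL : ∀ n : ℕ, (L n : WithBot ℕ∞) =
      moduleLength R (M ⧸ ((maximalIdeal R ^ n) • ⊤ : Submodule R M)))
    (μ : ℕ) (hμ : 1 ≤ μ)
    (hmult : Filter.Tendsto
      (fun n : ℕ => ((t.factorial : ℝ) * (L n : ℝ)) / (n : ℝ) ^ t)
      Filter.atTop (nhds (μ : ℝ))) :
    ∃ x : Fin t → R, (∀ i, x i ∈ maximalIdeal R) ∧
      IsFiniteLength R (M ⧸ ((Ideal.span (Set.range x)) • ⊤ : Submodule R M)) ∧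
      ∀ e : ℕ, μ ≤ p ^ e → ∀ r ∈ maximalIdeal R, ∀ m : M,
        (r ^ p ^ e) • m ∈ (Ideal.span (Set.range x)) • (⊤ : Submodule R M) := by
  have hd : Module.supportDim R M = t := by
    rw [Module.supportDim_eq_ringKrullDim_quotient_annihilator]; exact hdim
  obtain ⟨xs, hl, hm, hfin, c, hc⟩ := aux_main hk t M hd hCM
  subst hl
  have hspan : Ideal.span (Set.range xs.get) = Ideal.ofList xs := by
    rw [Ideal.ofList]
    congr 1
    ext r
    simp [List.mem_iff_get]
  have hne := Module.length_ne_top_iff.mpr hfin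
  obtain ⟨l, hl⟩ := ENat.ne_top_iff_exists.mp hne
  have hL' : ∀ n, (L n : ℕ∞) =
      Module.length R (M ⧸ ((maximalIdeal R ^ n) • ⊤ : Submodule R M)) := by
    intro n
    have h := hL n
    rw [moduleLength, ← Module.coe_length] at h
    exact_mod_cast h
  have hc' : ∀ n : ℕ, l * (n + xs.length).choose xs.length ≤ L (c + n) := by
    intro n
    have h := hc n
    rw [← hl, ← hL'] at h
    exact_mod_cast h
  have hlμ : l ≤ μ := by
    have h1 := hmult.comp (Filter.tendsto_add_atTop_nat c)
    have h2 : Filter.Tendsto (fun n : ℕ => (l : ℝ) * ((n : ℝ) / ((n : ℝ) + c)) ^ xs.length)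
        Filter.atTop (nhds ((l : ℝ) * 1 ^ xs.length)) :=
      ((tendsto_natCast_div_add_atTop (c : ℝ)).pow _).const_mul _
    rw [one_pow, mul_one] at h2
    have h3 := le_of_tendsto_of_tendsto' h2 h1 ?_
    · exact_mod_cast h3
    · intro n
      have h4 : (l : ℝ) * (n : ℝ) ^ xs.length ≤ (xs.length.factorial : ℝ) * (L (n + c) : ℝ) := by
        have h5 : n ^ xs.length ≤ xs.length.factorial * (n + xs.length).choose xs.length := by
          rw [← Nat.ascFactorial_eq_factorial_mul_choose]
          exact (Nat.pow_le_pow_left (Nat.le_succ n) _).trans (Nat.pow_succ_le_ascFactorial _ _)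
        have h6 := hc' n
        rw [add_comm c n] at h6
        have h7 : l * n ^ xs.length ≤ xs.length.factorial * L (n + c) := by
          calc l * n ^ xs.length
              ≤ l * (xs.length.factorial * (n + xs.length).choose xs.length) :=
                Nat.mul_le_mul_left _ h5
            _ = xs.length.factorial * (l * (n + xs.length).choose xs.length) := by ring
            _ ≤ _ := Nat.mul_le_mul_left _ h6
        exact_mod_cast h7
      simp only [Function.comp_apply]
      rw [div_pow, ← mul_div_assoc]
      push_cast
      gcongr
  refine ⟨xs.get, fun i => hm _ (List.get_mem _ _), ?_, ?_⟩
  · rw [hspan]; exact hfin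
  · intro e he r hr y
    rw [hspan]
    have h1 := aux_nil r hr (p ^ e) _ (hl.symm.le.trans (by exact_mod_cast hlμ.trans he))
      (Submodule.mkQ (Ideal.ofList xs • ⊤ : Submodule R M) y)
    rwa [← map_smul, Submodule.mkQ_apply, Submodule.Quotient.mk_eq_zero] at h1
end

section
/- Let (R, m) be a commutative Noetherian local ring, f : R → S a ring homomorphism, N a finitely generated R-module, and M a finitely generated S-module (viewed as an R-module via f). Suppose: (i) Ext_R^i(N, M) = 0 for all i = t, …, t+d−1, for some integers t ≥ 1, d ≥ 1; (ii) there exist x₁,…,x_d in the Jacobson radical of S forming an M-regular sequence with mM ⊆ (x₁,…,x_d)M. Then Hom_R(Ω^t N, M) = 0, where Ω^t N is the t-th syzygy of N in a minimal free resolution over R. -/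
open CategoryTheory IsLocalRing

/-- Restriction of scalars along `f : R →+* S`. -/
def Restrict {R S : Type} [CommRing R] [CommRing S] (f : R →+* S)
    (B : Type) [AddCommGroup B] [Module S B] : Type := B

instance {R S : Type} [CommRing R] [CommRing S] (f : R →+* S)
    (B : Type) [AddCommGroup B] [Module S B] : AddCommGroup (Restrict f B) :=
  inferInstanceAs (AddCommGroup B)

instance {R S : Type} [CommRing R] [CommRing S] (f : R →+* S)
    (B : Type) [AddCommGroup B] [Module S B] : Module R (Restrict f B) :=
  Module.compHom B f

/-- `Ext^n_R(A, B)`. -/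
noncomputable def extGroup (R : Type) [CommRing R] (n : ℕ)
    (A B : Type) [AddCommGroup A] [Module R A] [AddCommGroup B] [Module R B] : ModuleCat R :=
  ((Ext R (ModuleCat R) n).obj (Opposite.op (ModuleCat.of R A))).obj (ModuleCat.of R B)

section
open scoped Pointwise
theorem aux_lift {R S P M : Type} [CommRing R] [CommRing S] [Algebra R S]
    [AddCommGroup P] [Module R P] [Module.Free R P]
    [AddCommGroup M] [Module R M] [Module S M] [IsScalarTower R S M] (x : S)
    (g : P →ₗ[R] M) (h : ∀ y, ∃ m : M, x • m = g y) : ∃ u : P →ₗ[R] M, g = x • u := by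
  let b := Module.Free.chooseBasis R P
  choose m hm using h
  refine ⟨b.constr ℕ (fun i => m (b i)), b.ext fun i => ?_⟩
  simp [hm]

theorem aux_main_s15 {R S : Type} [CommRing R] [IsLocalRing R] [CommRing S] [Algebra R S]
    (F : ℕ → Type) [∀ i, AddCommGroup (F i)] [∀ i, Module R (F i)]
    [∀ i, Module.Free R (F i)] [∀ i, Module.Finite R (F i)]
    (δ : ∀ i : ℕ, F (i + 1) →ₗ[R] F i)
    (hδ : ∀ i, δ i ∘ₗ δ (i + 1) = 0)
    (hmin : ∀ i, LinearMap.range (δ i) ≤ (maximalIdeal R) • (⊤ : Submodule R (F i))) (s : ℕ)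
    (rs : List S) : ∀ (M : Type) [AddCommGroup M] [Module R M] [Module S M] [IsScalarTower R S M]
    [Module.Finite S M] (_ : ∀ x ∈ rs, x ∈ (⊥ : Ideal S).jacobson)
    (_ : RingTheory.Sequence.IsWeaklyRegular M rs)
    (_ : ∀ r ∈ maximalIdeal R, ∀ m : M,
      r • m ∈ Ideal.ofList rs • (⊤ : Submodule S M))
    (_ : ∀ j, s ≤ j → j < s + rs.length → ∀ g : F (j + 1) →ₗ[R] M, g ∘ₗ δ (j + 1) = 0 →
      ∃ h : F j →ₗ[R] M, g = h ∘ₗ δ j),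
    ∀ g : F s →ₗ[R] M, g ∘ₗ δ s = 0 := by
  induction rs with
  | nil =>
    intro M _ _ _ _ _ _ _ hm _ g
    ext y
    have h1 := hmin s (LinearMap.mem_range_self (δ s) y)
    simp only [LinearMap.comp_apply, LinearMap.zero_apply]
    generalize δ s y = z at h1 ⊢
    induction h1 using Submodule.smul_induction_on' with
    | smul r hr n _ => 
      have := hm r hr (g n)
      simpa using this
    | add a _ b _ ha hb => simp [ha, hb]
  | cons x rs ih =>
    intro M _ _ _ _ _ hJ hreg hm hE
    rw [RingTheory.Sequence.isWeaklyRegular_cons_iff] at hreg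
    obtain ⟨hx, hrs⟩ := hreg
    let q : M →ₗ[R] QuotSMulTop x M := (Submodule.mkQ (x • (⊤ : Submodule S M))).restrictScalars R
    have hqs : Function.Surjective q := Submodule.mkQ_surjective (x • (⊤ : Submodule S M))
    have hq : ∀ m, q m = 0 ↔ ∃ n : M, x • n = m := by
      intro m
      change Submodule.mkQ (x • (⊤ : Submodule S M)) m = 0 ↔ _
      rw [Submodule.mkQ_apply, Submodule.Quotient.mk_eq_zero, Submodule.mem_smul_pointwise_iff_exists]
      simp
    have hqx : ∀ m, q (x • m) = 0 := fun m => (hq _).2 ⟨m, rfl⟩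
    -- reduction step
    have step : ∀ j, s ≤ j → j < s + (x :: rs).length → ∀ g : F j →ₗ[R] M,
        (q ∘ₗ g) ∘ₗ δ j = 0 → ∃ h : F j →ₗ[R] M, (g - x • h) ∘ₗ δ j = 0 := by
      intro j h1 h2 g hg
      obtain ⟨u, hu⟩ := aux_lift x (g ∘ₗ δ j) (fun y => (hq _).1 (LinearMap.congr_fun hg y))
      have hu0 : u ∘ₗ δ (j + 1) = 0 := by
        ext y
        apply hx
        have h3 := LinearMap.congr_fun hu (δ (j+1) y)
        have h4 := LinearMap.congr_fun (hδ j) y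
        simp only [LinearMap.comp_apply, LinearMap.zero_apply, LinearMap.smul_apply] at h3 h4 ⊢
        rw [← h3, h4, map_zero, smul_zero]
      obtain ⟨h, rfl⟩ := hE j h1 h2 u hu0
      refine ⟨h, ?_⟩
      rw [LinearMap.sub_comp, hu, LinearMap.smul_comp, sub_self]
    have key := ih (QuotSMulTop x M) (fun y hy => hJ y (by simp [hy])) hrs ?_ ?_
    · intro g
      -- Nakayama
      let T : (F s →ₗ[R] M) →ₗ[S] (F (s+1) →ₗ[R] M) :=
        { toFun := fun g => g ∘ₗ δ s
          map_add' := fun a b => LinearMap.add_comp _ _ _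
          map_smul' := fun a b => LinearMap.smul_comp _ _ _ }
      have hfin : Module.Finite S (F s →ₗ[R] M) :=
        Module.Finite.equiv ((Module.Free.chooseBasis R (F s)).constr (M' := M) S)
      have hle : (⊤ : Submodule S (F s →ₗ[R] M)) ≤ LinearMap.ker T := by
        apply Submodule.le_of_le_smul_of_le_jacobson_bot (I := Ideal.span {x}) hfin.fg_top
        · rw [Ideal.span_singleton_le_iff_mem]; exact hJ x (by simp)
        · intro g _
          obtain ⟨h, hh⟩ := step s le_rfl (by simp) g (key _)
          have : g = (g - x • h) + x • h := by simp
          rw [this]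
          exact Submodule.add_mem_sup hh
            (Submodule.smul_mem_smul (Ideal.mem_span_singleton_self x) trivial)
      exact hle (x := g) trivial
    · intro r hr m
      obtain ⟨m, rfl⟩ := hqs m
      have h1 := hm r hr m
      rw [Ideal.ofList_cons, Submodule.sup_smul] at h1
      obtain ⟨a, ha, b, hb, hab⟩ := Submodule.mem_sup.1 h1
      have h2 : q a = 0 := by
        rw [Submodule.ideal_span_singleton_smul, Submodule.mem_smul_pointwise_iff_exists] at ha
        obtain ⟨n, _, rfl⟩ := ha
        exact hqx n
      rw [← map_smul, ← hab, map_add, h2, zero_add]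
      have h3 : (Submodule.mkQ (x • (⊤ : Submodule S M))) b ∈
        Submodule.map (Submodule.mkQ (x • (⊤ : Submodule S M))) (Ideal.ofList rs • ⊤) :=
        Submodule.mem_map_of_mem hb
      rw [Submodule.map_smul''] at h3
      exact Submodule.smul_mono le_rfl le_top h3
    · intro j h1 h2 g' hg'
      obtain ⟨g, rfl⟩ := Module.projective_lifting_property q g' hqs
      obtain ⟨h, hh⟩ := step (j+1) (by omega) (by simp; omega) g hg'
      obtain ⟨k, hk⟩ := hE j h1 (by simp; omega) _ hh
      refine ⟨q ∘ₗ k, ?_⟩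
      rw [LinearMap.comp_assoc, ← hk]
      ext y
      simp [hqx]
end

section
open CategoryTheory Limits
variable {R : Type} [CommRing R]
    {N : Type} [AddCommGroup N] [Module R N]
    (F : ℕ → Type) [∀ i, AddCommGroup (F i)] [∀ i, Module R (F i)]
    [∀ i, Module.Free R (F i)]
    (δ : ∀ i : ℕ, F (i + 1) →ₗ[R] F i) (ε : F 0 →ₗ[R] N)

noncomputable def auxCx (hδ : ∀ i, δ i ∘ₗ δ (i + 1) = 0) : ChainComplex (ModuleCat.{0} R) ℕ :=
  ChainComplex.of (fun i => ModuleCat.of R (F i)) (fun i => ModuleCat.ofHom (δ i))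
    (fun i => by rw [← ModuleCat.ofHom_comp, hδ]; rfl)

theorem auxCx_d (hδ : ∀ i, δ i ∘ₗ δ (i + 1) = 0) (i : ℕ) :
    (auxCx F δ hδ).d (i + 1) i = ModuleCat.ofHom (δ i) := 
  ChainComplex.of_d (fun i => ModuleCat.of R (F i)) (fun i => ModuleCat.ofHom (δ i)) i

noncomputable def auxRes (hδ : ∀ i, δ i ∘ₗ δ (i + 1) = 0) 
    (hε : Function.Surjective ε)
    (hex0 : LinearMap.range (δ 0) = LinearMap.ker ε)
    (hex : ∀ i, LinearMap.range (δ (i + 1)) = LinearMap.ker (δ i)) :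
    ProjectiveResolution (ModuleCat.of R N) where
  complex := auxCx F δ hδ
  projective n := (IsProjective.iff_projective (F n)).1 inferInstance
  π := (ChainComplex.toSingle₀Equiv _ _).symm ⟨ModuleCat.ofHom ε, by
    rw [auxCx_d]
    refine (ModuleCat.ofHom_comp _ _).symm.trans ?_
    rw [LinearMap.range_le_ker_iff.1 hex0.le]; rfl⟩
  quasiIso := ⟨fun n => by
    cases n with
    | zero =>
      rw [ChainComplex.quasiIsoAt₀_iff, ShortComplex.quasiIso_iff_of_zeros']
      · have h0 : ModuleCat.ofHom (δ 0) ≫ ModuleCat.ofHom ε = 0 := by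
          rw [← ModuleCat.ofHom_comp, LinearMap.range_le_ker_iff.1 hex0.le]; rfl
        refine (ShortComplex.exact_and_epi_g_iff_of_iso (S₂ := ShortComplex.mk _ _ h0) ?_).2
          ⟨?_, ?_⟩
        · exact ShortComplex.isoMk (Iso.refl _) (Iso.refl _) (Iso.refl _)
            ((Category.id_comp _).trans ((auxCx_d F δ hδ 0).symm.trans (Category.comp_id _).symm)) (by simp; rfl)
        · rw [ShortComplex.moduleCat_exact_iff_range_eq_ker]
          exact hex0
        · exact (ModuleCat.epi_iff_surjective _).2 hε
      all_goals rfl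
    | succ n =>
      rw [quasiIsoAt_iff_exactAt']
      · rw [HomologicalComplex.exactAt_iff' _ (n + 1 + 1) (n + 1) n (by simp) (by simp)]
        rw [ShortComplex.moduleCat_exact_iff_range_eq_ker]
        change LinearMap.range ((auxCx F δ hδ).d (n+1+1) (n+1)).hom = LinearMap.ker ((auxCx F δ hδ).d (n+1) n).hom
        rw [auxCx_d, auxCx_d]
        exact hex n
      · apply ChainComplex.exactAt_succ_single_obj⟩

theorem auxExt (hδ : ∀ i, δ i ∘ₗ δ (i + 1) = 0) 
    (hε : Function.Surjective ε)
    (hex0 : LinearMap.range (δ 0) = LinearMap.ker ε)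
    (hex : ∀ i, LinearMap.range (δ (i + 1)) = LinearMap.ker (δ i))
    (M : Type) [AddCommGroup M] [Module R M] (j : ℕ)
    (h : Subsingleton (extGroup R (j + 1) N M)) (g : F (j + 1) →ₗ[R] M)
    (hg : g ∘ₗ δ (j + 1) = 0) : ∃ h : F j →ₗ[R] M, g = h ∘ₗ δ j := by
  let P := auxRes F δ ε hδ hε hex0 hex
  have hz : IsZero ((P.complex.linearYonedaObj R (ModuleCat.of R M)).homology (j+1)) :=
    IsZero.of_iso (ModuleCat.isZero_of_subsingleton (extGroup R (j + 1) N M))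
      (P.isoExt (R := R) (j+1) (ModuleCat.of R M)).symm
  rw [← HomologicalComplex.exactAt_iff_isZero_homology,
    HomologicalComplex.exactAt_iff' _ j (j+1) (j+1+1) (by simp) (by simp),
    ShortComplex.moduleCat_exact_iff] at hz
  have h1 := hz (ModuleCat.ofHom g) ?_
  · obtain ⟨k, hk⟩ := h1
    have hk' : (auxCx F δ hδ).d (j+1) j ≫ k = ModuleCat.ofHom g := hk
    rw [auxCx_d] at hk'
    refine ⟨ModuleCat.Hom.hom k, ?_⟩
    exact (congrArg ModuleCat.Hom.hom hk').symm
  · change (auxCx F δ hδ).d (j+1+1) (j+1) ≫ ModuleCat.ofHom g = 0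
    rw [auxCx_d]
    refine (ModuleCat.ofHom_comp _ _).symm.trans ?_
    rw [hg]; rfl
end

theorem stmt_15 (R : Type) [CommRing R] [IsNoetherianRing R] [IsLocalRing R]
    (S : Type) [CommRing S] [IsNoetherianRing S] (f : R →+* S)
    (N : Type) [AddCommGroup N] [Module R N] [Module.Finite R N]
    (M : Type) [AddCommGroup M] [Module S M] [Module.Finite S M]
    (t d : ℕ) (ht : 1 ≤ t) (hd : 1 ≤ d)
    (hvanish : ∀ i, t ≤ i → i < t + d → Subsingleton (extGroup R i N (Restrict f M)))
    (x : Fin d → S) (hxJac : ∀ i, x i ∈ (⊥ : Ideal S).jacobson)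
    (hreg : RingTheory.Sequence.IsRegular M (List.ofFn x))
    (hmM : ∀ r ∈ maximalIdeal R, ∀ m : M,
      f r • m ∈ (Ideal.span (Set.range x)) • (⊤ : Submodule S M))
    -- a minimal free resolution `⋯ → F₁ → F₀ → N → 0` of `N` over `R`:
    (F : ℕ → Type) [∀ i, AddCommGroup (F i)] [∀ i, Module R (F i)]
    [∀ i, Module.Free R (F i)] [∀ i, Module.Finite R (F i)]
    (δ : ∀ i : ℕ, F (i + 1) →ₗ[R] F i) (ε : F 0 →ₗ[R] N)
    (hε : Function.Surjective ε)
    (hex0 : LinearMap.range (δ 0) = LinearMap.ker ε)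
    (hex : ∀ i, LinearMap.range (δ (i + 1)) = LinearMap.ker (δ i))
    (hminε : LinearMap.ker ε ≤ (maximalIdeal R) • (⊤ : Submodule R (F 0)))
    (hminδ : ∀ i, LinearMap.range (δ i) ≤ (maximalIdeal R) • (⊤ : Submodule R (F i))) :
    ∀ φ : ↥(LinearMap.range (δ (t - 1))) →ₗ[R] Restrict f M, φ = 0 := by
  obtain ⟨s, rfl⟩ : ∃ s, t = s + 1 := ⟨t - 1, by omega⟩
  have hδ : ∀ i, δ i ∘ₗ δ (i + 1) = 0 := fun i => LinearMap.range_le_ker_iff.1 (hex i).le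
  let _ : Algebra R S := f.toAlgebra
  let _ : Module S (Restrict f M) := inferInstanceAs (Module S M)
  have : Module.Finite S (Restrict f M) := inferInstanceAs (Module.Finite S M)
  have : IsScalarTower R S (Restrict f M) := ⟨fun r a m => mul_smul (f r) a (show M from m)⟩
  have hE : ∀ j, s ≤ j → j < s + d → ∀ g : F (j + 1) →ₗ[R] Restrict f M, g ∘ₗ δ (j + 1) = 0 →
      ∃ h : F j →ₗ[R] Restrict f M, g = h ∘ₗ δ j := fun j h1 h2 g hg =>
    auxExt F δ ε hδ hε hex0 hex (Restrict f M) j (hvanish (j + 1) (by omega) (by omega)) g hg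
  have key := aux_main_s15 F δ hδ hminδ s (List.ofFn x) (Restrict f M)
    (by simpa [List.mem_ofFn] using hxJac) hreg.toIsWeaklyRegular
    (fun r hr m => by
      have hI : Ideal.ofList (List.ofFn x) = Ideal.span (Set.range x) := by
        unfold Ideal.ofList
        congr 1
        ext y
        simp [List.mem_ofFn]
      rw [hI]
      exact hmM r hr m)
    (by simpa using hE)
  intro φ
  change ↥(LinearMap.range (δ s)) →ₗ[R] Restrict f M at φ
  obtain ⟨h, hh⟩ := hE s le_rfl (by omega) (φ ∘ₗ (δ s).rangeRestrict) (by
    have : (δ s).rangeRestrict ∘ₗ δ (s + 1) = 0 := by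
      ext y
      exact LinearMap.congr_fun (hδ s) y
    rw [LinearMap.comp_assoc, this, LinearMap.comp_zero])
  rw [key h] at hh
  refine LinearMap.ext fun z => ?_
  obtain ⟨y, rfl⟩ := (δ s).surjective_rangeRestrict z
  exact LinearMap.congr_fun hh y
end

section
/- Let (R, m, k) be a d-dimensional commutative Noetherian local ring of prime characteristic p with depth R ≥ 1, M a finitely generated Cohen-Macaulay R-module with Supp_R(M) = Spec(R), and N a finitely generated R-module. If for some t ≥ 1 and all sufficiently large e one has Ext_R^i(N, eM) = 0 for all i = t, …, t+d−1, then pd_R(N) ≤ min{t−1, depth R}. -/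
open CategoryTheory IsLocalRing

/-- `M` viewed as an `R`-module through the `e`-th iterate of Frobenius. -/
def FrobTwist (R : Type) [CommRing R] (p : ℕ) [ExpChar R p] (e : ℕ)
    (M : Type) [AddCommGroup M] [Module R M] : Type := M

instance (R : Type) [CommRing R] (p : ℕ) [ExpChar R p] (e : ℕ)
    (M : Type) [AddCommGroup M] [Module R M] : AddCommGroup (FrobTwist R p e M) :=
  inferInstanceAs (AddCommGroup M)

instance (R : Type) [CommRing R] (p : ℕ) [ExpChar R p] (e : ℕ)
    (M : Type) [AddCommGroup M] [Module R M] : Module R (FrobTwist R p e M) :=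
  Module.compHom M (iterateFrobenius R p e)

/-- `pd_R Y ≤ n`, via vanishing of `Ext^i_R(Y, X)` for all `X` and `i > n`. -/
noncomputable def projDimLE (R : Type) [CommRing R]
    (Y : Type) [AddCommGroup Y] [Module R Y] (n : ℕ) : Prop :=
  ∀ (X : ModuleCat R) (i : ℕ), n < i →
    Subsingleton (((Ext R (ModuleCat R) i).obj (Opposite.op (ModuleCat.of R Y))).obj X)


theorem oldExt_iff {R : Type} [CommRing R] (A B : ModuleCat.{0} R) (P : ProjectiveResolution A) (n : ℕ) :
    Subsingleton (((Ext R (ModuleCat R) (n+1)).obj (Opposite.op A)).obj B) ↔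
    ∀ f : P.complex.X (n+1) ⟶ B, P.complex.d (n+2) (n+1) ≫ f = 0 →
      ∃ g : P.complex.X n ⟶ B, P.complex.d (n+1) n ≫ g = f := by
  rw [← ModuleCat.isZero_iff_subsingleton, (P.isoExt (n+1) B).isZero_iff, ← HomologicalComplex.exactAt_iff_isZero_homology,
    HomologicalComplex.exactAt_iff' _ n (n+1) (n+2) (by simp) (by simp), ShortComplex.moduleCat_exact_iff]
  exact Iff.rfl

theorem newExt_iff {R : Type} [CommRing R] (A B : ModuleCat.{0} R) (P : ProjectiveResolution A) (n : ℕ) :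
    Subsingleton (Abelian.Ext A B (n+1)) ↔
    ∀ f : P.complex.X (n+1) ⟶ B, P.complex.d (n+2) (n+1) ≫ f = 0 →
      ∃ g : P.complex.X n ⟶ B, P.complex.d (n+1) n ≫ g = f := by
  constructor
  · intro h f hf
    exact (P.extMk_eq_zero_iff f (n+2) rfl hf n rfl).1 (Subsingleton.elim _ _)
  · intro h
    refine subsingleton_of_forall_eq 0 fun x => ?_
    obtain ⟨f, hf, rfl⟩ := P.extMk_surjective x (n+2) rfl
    exact (P.extMk_eq_zero_iff f (n+2) rfl hf n rfl).2 (h f hf)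

theorem old_iff_new {R : Type} [CommRing R] (A B : ModuleCat.{0} R) (n : ℕ) (hn : 1 ≤ n) :
    Subsingleton (((Ext R (ModuleCat R) n).obj (Opposite.op A)).obj B) ↔
    Subsingleton (Abelian.Ext A B n) := by
  obtain ⟨n, rfl⟩ := Nat.exists_eq_add_of_le' hn
  rw [oldExt_iff A B (projectiveResolution A), newExt_iff A B (projectiveResolution A)]

theorem old_zero {R : Type} [CommRing R] (A B : ModuleCat.{0} R) 
    (h : Subsingleton (((Ext R (ModuleCat R) 0).obj (Opposite.op A)).obj B)) :
    Subsingleton (Abelian.Ext A B 0) := by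
  let P := projectiveResolution A
  rw [← ModuleCat.isZero_iff_subsingleton, (P.isoExt 0 B).isZero_iff, ← HomologicalComplex.exactAt_iff_isZero_homology,
    HomologicalComplex.exactAt_iff' _ 0 0 1 (by simp) (by simp), ShortComplex.moduleCat_exact_iff] at h
  have h' : ∀ f : P.complex.X 0 ⟶ B, P.complex.d 1 0 ≫ f = 0 →
      ∃ g : P.complex.X 0 ⟶ B, P.complex.d 0 0 ≫ g = f := h
  refine subsingleton_of_forall_eq 0 fun x => ?_
  obtain ⟨f, hf, rfl⟩ := P.extMk_surjective x 1 rfl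
  obtain ⟨g, hg⟩ := h' f hf
  have : P.complex.d 0 0 = 0 := P.complex.shape _ _ (by simp)
  rw [this, Limits.zero_comp] at hg
  subst hg
  simp


theorem exists_minimal_cover (R : Type) [CommRing R] [IsLocalRing R] (N : Type) [AddCommGroup N] [Module R N]
    [Module.Finite R N] : ∃ (n : ℕ) (f : (Fin n → R) →ₗ[R] N), Function.Surjective f ∧
      LinearMap.ker f ≤ maximalIdeal R • (⊤ : Submodule R (Fin n → R)) := by
  classical
  have hex : ∃ n : ℕ, ∃ f : (Fin n → R) →ₗ[R] N, Function.Surjective f := Module.Finite.exists_fin' R N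
  obtain ⟨f, hf⟩ := Nat.find_spec hex
  have hmin := fun m (hm : m < Nat.find hex) => Nat.find_min hex hm
  generalize Nat.find hex = n at *
  refine ⟨n, f, hf, ?_⟩
  intro c hc
  have key : ∀ j, c j ∈ maximalIdeal R := by
    intro j
    by_contra hj
    have hu : IsUnit (c j) := by
      by_contra h; exact hj h
    obtain ⟨u, hu⟩ := hu
    obtain ⟨m, rfl⟩ : ∃ m, n = m + 1 := ⟨n - 1, by have := j.2; omega⟩
    refine hmin m (by omega) ⟨f ∘ₗ (LinearMap.pi fun i => ?_), ?_⟩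
    · exact if h : ∃ k, j.succAbove k = i then LinearMap.proj h.choose else 0
    · intro x
      obtain ⟨a, ha⟩ := hf x
      refine ⟨fun k => (a - (a j * (↑u⁻¹ : R)) • c) (j.succAbove k), ?_⟩
      rw [← ha, LinearMap.comp_apply]
      have : f a = f (a - (a j * (↑u⁻¹ : R)) • c) := by
        rw [map_sub, map_smul, LinearMap.mem_ker.1 hc, smul_zero, sub_zero]
      rw [this]
      congr 1
      ext i
      rw [LinearMap.pi_apply]
      by_cases h : ∃ k, j.succAbove k = i
      · rw [dif_pos h, LinearMap.proj_apply, h.choose_spec]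
      · rw [dif_neg h]
        have : i = j := by
          by_contra hij
          exact h (Fin.exists_succAbove_eq hij)
        subst this
        simp [← hu]
  have : c = ∑ j, c j • (Pi.single j 1 : Fin n → R) := by
    ext i; simp [Finset.sum_apply, Pi.single_apply]
  rw [this]
  exact Submodule.sum_mem _ fun j _ => Submodule.smul_mem_smul (key j) trivial

/-- AB step -/
theorem comp_zero {R : Type} [CommRing R] (A : ModuleCat.{0} R) (I : Ideal R) (hI : I ≤ Module.annihilator R A)
   (F : ModuleCat.{0} R) (v : F) (hv : v ∈ I • (⊤ : Submodule R F)) (i : ℕ)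
   (x : Abelian.Ext A (ModuleCat.of R R) i) :
   x.comp (Abelian.Ext.mk₀ (ModuleCat.ofHom (LinearMap.toSpanSingleton R F v))) (add_zero i) = 0 := by
  induction hv using Submodule.smul_induction_on' with
  | smul r hr w hw =>
    have h0 : r • x = 0 := by
      have h1 : r • 𝟙 A = 0 := by
        simp [← ModuleCat.lsmul_eq_smul_id, Module.mem_annihilator_iff_lsmul_eq_zero.mp (hI hr)]
      have : r • x = (Abelian.Ext.mk₀ (r • 𝟙 A)).comp x (zero_add i) := by simp [Abelian.Ext.mk₀_smul]
      rw [this, h1]; simp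
    have : ModuleCat.ofHom (LinearMap.toSpanSingleton R F (r • w)) = r • ModuleCat.ofHom (LinearMap.toSpanSingleton R F w) := by
      ext; simp
    rw [this, Abelian.Ext.mk₀_smul, Abelian.Ext.comp_smul, ← Abelian.Ext.smul_comp, h0]
    simp
  | add v hv w hw h1 h2 =>
    have : ModuleCat.ofHom (LinearMap.toSpanSingleton R F (v + w)) = ModuleCat.ofHom (LinearMap.toSpanSingleton R F v) + ModuleCat.ofHom (LinearMap.toSpanSingleton R F w) := by
      ext; simp
    rw [this, Abelian.Ext.mk₀_add, Abelian.Ext.comp_add, h1, h2, add_zero]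

theorem ext_pi {R : Type} [CommRing R] (A : ModuleCat.{0} R) (i n : ℕ)
    (h : Subsingleton (Abelian.Ext A (ModuleCat.of R R) i)) :
    Subsingleton (Abelian.Ext A (ModuleCat.of R (Fin n → R)) i) := by
  classical
  refine subsingleton_of_forall_eq 0 fun x => ?_
  have hid : 𝟙 (ModuleCat.of R (Fin n → R)) = ∑ j : Fin n,
      (ModuleCat.ofHom (LinearMap.proj (R := R) (φ := fun _ : Fin n => R) j) : _ ⟶ ModuleCat.of R R) ≫
        ModuleCat.ofHom (LinearMap.single R (fun _ : Fin n => R) j) := by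
    ext v k
    simp [ModuleCat.hom_sum, LinearMap.sum_apply, Pi.single_apply]
  rw [← Abelian.Ext.comp_mk₀_id x, hid, Abelian.Ext.mk₀_sum, Abelian.Ext.comp_sum]
  refine Finset.sum_eq_zero fun j _ => ?_
  rw [← Abelian.Ext.mk₀_comp_mk₀, ← Abelian.Ext.comp_assoc_of_second_deg_zero,
    Subsingleton.elim (x.comp (Abelian.Ext.mk₀ (ModuleCat.ofHom (LinearMap.proj (R := R) (φ := fun _ : Fin n => R) j) : _ ⟶ ModuleCat.of R R)) (add_zero i)) 0,
    Abelian.Ext.zero_comp]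

theorem auslander_buchsbaum {R : Type} [CommRing R] [IsNoetherianRing R] [IsLocalRing R]
    (s : ℕ) (hs1 : 1 ≤ s)
    (hs : ∀ i < s, Subsingleton (Abelian.Ext (ModuleCat.of R (ResidueField R)) (ModuleCat.of R R) i))
    (hs' : ¬ Subsingleton (Abelian.Ext (ModuleCat.of R (ResidueField R)) (ModuleCat.of R R) s))
    (n : ℕ) : ∀ (j : ℕ), j ≤ s → ∀ (N : Type) [AddCommGroup N] [Module R N] [Module.Finite R N],
      HasProjectiveDimensionLT (ModuleCat.of R N) (n + 1) →
      (∀ i < j, Subsingleton (Abelian.Ext (ModuleCat.of R (ResidueField R)) (ModuleCat.of R N) i)) →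
      HasProjectiveDimensionLT (ModuleCat.of R N) (s - j + 1) := by
  induction n with
  | zero =>
    intro j hj N _ _ _ h _
    exact hasProjectiveDimensionLT_of_ge (ModuleCat.of R N) 1 _ (by omega)
  | succ n ih =>
    intro j hj N _ _ _ h hk
    obtain ⟨b, f, hf, hker⟩ := exists_minimal_cover R N
    have hS := LinearMap.shortExact_shortComplexKer hf
    have hfree : Projective (ModuleCat.of R (Fin b → R)) := inferInstance
    have hK : HasProjectiveDimensionLT (ModuleCat.of R (LinearMap.ker f)) (n + 1) :=
      (hS.hasProjectiveDimensionLT_X₃_iff n hfree).1 h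
    have hKe : ∀ i < s, i < j + 1 → Subsingleton
        (Abelian.Ext (ModuleCat.of R (ResidueField R)) (ModuleCat.of R (LinearMap.ker f)) i) := by
      intro i his hij
      have hF := ext_pi (ModuleCat.of R (ResidueField R)) i b (hs i his)
      refine subsingleton_of_forall_eq 0 fun x => ?_
      cases i with
      | zero =>
        have : Mono f.shortComplexKer.f := hS.mono_f
        apply Abelian.Ext.postcomp_mk₀_injective_of_mono _ f.shortComplexKer.f
        exact hF.elim _ _
      | succ i =>
        obtain ⟨y, hy⟩ := Abelian.Ext.covariant_sequence_exact₁ _ hS x (hF.elim _ _) rfl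
        have := hk i (by omega)
        rw [← hy, this.elim y 0, Abelian.Ext.zero_comp]
    rcases Nat.lt_or_ge j s with hjs | hjs
    · have := ih (j + 1) hjs (LinearMap.ker f) hK (fun i hi => hKe i (by omega) hi)
      have h2 := (hS.hasProjectiveDimensionLT_X₃_iff (s - (j + 1)) hfree).2 this
      have e : s - (j + 1) + 2 = s - j + 1 := by omega
      rwa [e] at h2
    · obtain rfl : j = s := le_antisymm hj hjs
      have hp := ih j le_rfl (LinearMap.ker f) hK (fun i hi => hKe i hi (by omega))
      rw [Nat.sub_self, zero_add, ← projective_iff_hasProjectiveDimensionLT_one,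
        ← IsProjective.iff_projective] at hp
      have hfr : Module.Free R (LinearMap.ker f) := Module.free_of_flat_of_isLocalRing
      have hbot : LinearMap.ker f = ⊥ := by
        by_contra hne
        have : Nontrivial (LinearMap.ker f) := Submodule.nontrivial_iff_ne_bot.2 hne
        let B := Module.Free.chooseBasis R (LinearMap.ker f)
        obtain ⟨i0⟩ := B.index_nonempty
        apply hs'
        refine subsingleton_of_forall_eq 0 fun x => ?_
        let ι : ModuleCat.of R R ⟶ ModuleCat.of R (LinearMap.ker f) :=
          ModuleCat.ofHom (LinearMap.toSpanSingleton R _ (B i0))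
        let π : ModuleCat.of R (LinearMap.ker f) ⟶ ModuleCat.of R R := ModuleCat.ofHom (B.coord i0)
        have hιπ : ι ≫ π = 𝟙 _ := by ext; simp [ι, π]
        have h1 : x.comp (Abelian.Ext.mk₀ ι) (add_zero j) = 0 := by
          obtain ⟨i, rfl⟩ := Nat.exists_eq_add_of_le' hs1
          have hz : (x.comp (Abelian.Ext.mk₀ ι) (add_zero _)).comp
              (Abelian.Ext.mk₀ f.shortComplexKer.f) (add_zero _) = 0 := by
            rw [Abelian.Ext.comp_assoc_of_second_deg_zero, Abelian.Ext.mk₀_comp_mk₀]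
            have : ι ≫ f.shortComplexKer.f = ModuleCat.ofHom (LinearMap.toSpanSingleton R (Fin b → R) (B i0 : Fin b → R)) := by
              ext; simp [ι]
            rw [this]
            refine comp_zero (ModuleCat.of R (ResidueField R)) (maximalIdeal R) ?_ (ModuleCat.of R (Fin b → R)) _ (hker (B i0).2) _ x
            exact (Ideal.annihilator_quotient (I := maximalIdeal R)).ge
          obtain ⟨y, hy⟩ := Abelian.Ext.covariant_sequence_exact₁ _ hS _ hz rfl
          have := hk i (by omega)
          rw [← hy, this.elim y 0, Abelian.Ext.zero_comp]
        rw [← Abelian.Ext.comp_mk₀_id x, ← hιπ, ← Abelian.Ext.mk₀_comp_mk₀,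
          ← Abelian.Ext.comp_assoc_of_second_deg_zero, h1, Abelian.Ext.zero_comp]
      have e : (Fin b → R) ≃ₗ[R] N := LinearEquiv.ofBijective f ⟨LinearMap.ker_eq_bot.1 hbot, hf⟩
      have : Module.Projective R N := Module.Projective.of_equiv e
      have : Projective (ModuleCat.of R N) := inferInstance
      rw [Nat.sub_self, zero_add]
      infer_instance

theorem exists_L {R : Type} [CommRing R] [IsNoetherianRing R] [IsLocalRing R]
    (Q : PrimeSpectrum R) (n : ℕ) : ∀ (M : ModuleCat.{0} R) [Module.Finite R M],
    Q ∈ Module.support R M →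
    (∀ i < n, Subsingleton (Abelian.Ext (ModuleCat.of R (R ⧸ Q.asIdeal)) M i)) →
    ∃ L : ModuleCat.{0} R, Module.Finite R L ∧ Q ∈ Module.support R L ∧
      Module.supportDim R L + n = Module.supportDim R M ∧
      ∀ (F : ModuleCat.{0} R ⥤ ModuleCat.{0} R) [F.Additive] [Limits.PreservesFiniteLimits F]
        [Limits.PreservesFiniteColimits F] (A : ModuleCat.{0} R) (a m : ℕ),
        (∀ i, a ≤ i → i < a + n + m → Subsingleton (Abelian.Ext A (F.obj M) i)) →
        ∀ i, a ≤ i → i < a + m → Subsingleton (Abelian.Ext A (F.obj L) i) := by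
  induction n with
  | zero =>
    intro M _ hQ _
    exact ⟨M, inferInstance, hQ, by simp, fun F _ _ _ A a m h => by simpa using h⟩
  | succ n ih =>
    intro M _ hQ hext
    have hsub : Subsingleton (ModuleCat.of R (R ⧸ Q.asIdeal) ⟶ M) :=
      Abelian.Ext.addEquiv₀.subsingleton_congr.mp (hext 0 n.zero_lt_succ)
    have hsub' : Subsingleton ((R ⧸ Q.asIdeal) →ₗ[R] M) := (ModuleCat.homAddEquiv (M := ModuleCat.of R (R ⧸ Q.asIdeal)) (N := M)).symm.subsingleton
    obtain ⟨x, hxann, hx⟩ := IsSMulRegular.subsingleton_linearMap_iff.mp hsub'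
    rw [Ideal.annihilator_quotient] at hxann
    have hxm : x ∈ maximalIdeal R := IsLocalRing.le_maximalIdeal Q.2.ne_top hxann
    have hS := hx.smulShortComplex_shortExact
    have step : ∀ (F : ModuleCat.{0} R ⥤ ModuleCat.{0} R) [F.Additive] [Limits.PreservesFiniteLimits F]
        [Limits.PreservesFiniteColimits F] (A : ModuleCat.{0} R) (i : ℕ),
        Subsingleton (Abelian.Ext A (F.obj M) i) → Subsingleton (Abelian.Ext A (F.obj M) (i+1)) →
        Subsingleton (Abelian.Ext A (F.obj (ModuleCat.of R (QuotSMulTop x M))) i) := by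
      intro F _ _ _ A i h1 h2
      have hFS := hS.map_of_exact F
      refine subsingleton_of_forall_eq 0 fun y => ?_
      obtain ⟨z, hz⟩ := Abelian.Ext.covariant_sequence_exact₃ A hFS y rfl (h2.elim _ _)
      have hz0 : z = 0 := h1.elim _ _
      rw [hz0, Abelian.Ext.zero_comp] at hz
      exact hz.symm
    obtain ⟨L, hL1, hL2, hL3, hL4⟩ := ih (ModuleCat.of R (QuotSMulTop x M))
      (by
        change Q ∈ Module.support R (QuotSMulTop x M)
        rw [Module.support_quotSMulTop]
        exact ⟨hQ, by simpa using hxann⟩)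
      (fun i hi => step (𝟭 _) _ i (hext i (by omega)) (hext (i+1) (by omega)))
    refine ⟨L, hL1, hL2, ?_, ?_⟩
    · have h := Module.supportDim_quotSMulTop_succ_eq_supportDim hx hxm
      rw [← h]
      change _ = Module.supportDim R (ModuleCat.of R (QuotSMulTop x M)) + 1
      rw [← hL3]
      push_cast
      rw [add_assoc]
    · intro F _ _ _ A a m h
      exact hL4 F A a m fun i h1 h2 => step F A i (h i h1 (by omega)) (h (i+1) (by omega) (by omega))

theorem ischebeck {R : Type} [CommRing R] [IsNoetherianRing R] [IsLocalRing R]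
    (Q : PrimeSpectrum R) (hQm : Q.asIdeal ≠ maximalIdeal R)
    (hQ : ∀ P : Ideal R, P.IsPrime → Q.asIdeal < P → P = maximalIdeal R)
    (M : ModuleCat.{0} R) [Module.Finite R M] [Nontrivial M] (rs : List R)
    (hrs : ∀ r ∈ rs, r ∈ maximalIdeal R) (hreg : RingTheory.Sequence.IsRegular M rs) :
    ∀ i, i + 1 < rs.length → Subsingleton (Abelian.Ext (ModuleCat.of R (R ⧸ Q.asIdeal)) M i) := by
  intro i hi
  have hlt : Q.asIdeal < maximalIdeal R := lt_of_le_of_ne (IsLocalRing.le_maximalIdeal Q.2.ne_top) hQm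
  obtain ⟨x, hxm, hxQ⟩ := SetLike.exists_of_lt hlt
  have hx : IsSMulRegular (ModuleCat.of R (R ⧸ Q.asIdeal)) x := by
    intro a b hab
    obtain ⟨a, rfl⟩ := Ideal.Quotient.mk_surjective a
    obtain ⟨b, rfl⟩ := Ideal.Quotient.mk_surjective b
    have h1 : Ideal.Quotient.mk Q.asIdeal (x * a) = Ideal.Quotient.mk Q.asIdeal (x * b) := hab
    rw [Ideal.Quotient.eq, ← mul_sub] at h1
    rw [Ideal.Quotient.eq]
    exact (Q.2.mem_or_mem h1).resolve_left hxQ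
  have hS := hx.smulShortComplex_shortExact
  have hmt : maximalIdeal R • (⊤ : Submodule R M) < ⊤ :=
    (Submodule.top_ne_ideal_smul_of_le_jacobson_annihilator
      (IsLocalRing.maximalIdeal_le_jacobson _)).symm.lt_top
  have hsupp : Module.support R (QuotSMulTop x (R ⧸ Q.asIdeal)) ⊆ PrimeSpectrum.zeroLocus (maximalIdeal R) := by
    rw [Module.support_quotSMulTop]
    rintro P ⟨hP1, hP2⟩
    rw [Module.support_eq_zeroLocus, Ideal.annihilator_quotient] at hP1
    have h1 : Q.asIdeal ≤ P.asIdeal := hP1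
    have h2 : x ∈ P.asIdeal := by simpa using hP2
    have := hQ P.asIdeal P.2 (lt_of_le_of_ne h1 (fun h => hxQ (h ▸ h2)))
    exact this.ge
  have hvan := ModuleCat.subsingleton_ext_of_exists_isRegular (maximalIdeal R)
    (ModuleCat.of R (QuotSMulTop x (R ⧸ Q.asIdeal))) hsupp M hmt rs hrs hreg (i + 1) hi
  have hfin : Module.Finite R (Abelian.Ext (ModuleCat.of R (R ⧸ Q.asIdeal)) M i) := inferInstance
  have htop : (⊤ : Submodule R (Abelian.Ext (ModuleCat.of R (R ⧸ Q.asIdeal)) M i)) ≤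
      maximalIdeal R • ⊤ := by
    intro y _
    obtain ⟨z, hz⟩ := Abelian.Ext.contravariant_sequence_exact₁ hS M y (add_comm 1 i) (hvan.elim _ _)
    have hz' : ∀ z' : Abelian.Ext (ModuleCat.of R (R ⧸ Q.asIdeal)) M i,
        (Abelian.Ext.mk₀ (x • 𝟙 (ModuleCat.of R (R ⧸ Q.asIdeal)))).comp z' (zero_add i) = x • z' := by
      intro z'
      rw [Abelian.Ext.mk₀_smul, Abelian.Ext.smul_comp, Abelian.Ext.mk₀_id_comp]
    have : y = x • (show Abelian.Ext (ModuleCat.of R (R ⧸ Q.asIdeal)) M i from z) :=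
      hz.symm.trans (hz' z)
    rw [this]
    exact Submodule.smul_mem_smul hxm trivial
  have := Submodule.eq_bot_of_le_smul_of_le_jacobson_bot (maximalIdeal R) ⊤ Module.Finite.fg_top htop
    (IsLocalRing.maximalIdeal_le_jacobson _)
  exact (Submodule.subsingleton_iff R).1 (subsingleton_of_bot_eq_top this.symm)

theorem semilinear_zero {R : Type} [CommRing R] [IsNoetherianRing R] [IsLocalRing R]
    (φ : R →+* R) (F L : Type) [AddCommGroup F] [Module R F] [AddCommGroup L] [Module R L]
    [Module.Finite R L] (y : R) (hym : y ∈ maximalIdeal R) (hy : IsSMulRegular L y)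
    (hφ : ∀ r ∈ maximalIdeal R, ∀ l : L, ∃ l', φ r • l = y • l')
    (K : Submodule R F) (hK : K ≤ maximalIdeal R • (⊤ : Submodule R F))
    (hext : ∀ h : K →ₛₗ[φ] L, ∃ g : F →ₛₗ[φ] L, ∀ u : K, g u = h u)
    (h : K →ₛₗ[φ] L) : h = 0 := by
  have hdiv : ∀ h : K →ₛₗ[φ] L, ∀ u : K, ∃ l, h u = y • l := by
    intro h u
    obtain ⟨g, hg⟩ := hext h
    rw [← hg]
    have hu := hK u.2
    generalize (u : F) = w at hu
    induction hu using Submodule.smul_induction_on' with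
    | smul r hr w hw =>
      rw [map_smulₛₗ]
      exact hφ r hr _
    | add v hv w hw h1 h2 =>
      obtain ⟨a, ha⟩ := h1
      obtain ⟨b, hb⟩ := h2
      exact ⟨a + b, by rw [map_add, ha, hb, smul_add]⟩
  have hdiv' : ∀ h : K →ₛₗ[φ] L, ∃ h' : K →ₛₗ[φ] L, ∀ u, h u = y • h' u := by
    intro h
    choose h' hh' using hdiv h
    refine ⟨{ toFun := h', map_add' := ?_, map_smul' := ?_ }, hh'⟩
    · intro u v
      apply hy
      change y • h' (u + v) = y • (h' u + h' v)
      rw [smul_add, ← hh', ← hh', ← hh', map_add]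
    · intro r u
      apply hy
      change y • h' (r • u) = y • (φ r • h' u)
      rw [smul_comm, ← hh', ← hh', map_smulₛₗ]
  have hpow : ∀ n : ℕ, ∀ h : K →ₛₗ[φ] L, ∀ u, h u ∈ (maximalIdeal R)^n • (⊤ : Submodule R L) := by
    intro n
    induction n with
    | zero => intro h u; simp
    | succ n ih =>
      intro h u
      obtain ⟨h', hh'⟩ := hdiv' h
      rw [hh', pow_succ', mul_smul]
      exact Submodule.smul_mem_smul hym (ih h' u)
  ext u
  have := Ideal.iInf_pow_smul_eq_bot_of_isLocalRing (R := R) (M := L) (maximalIdeal R) (Ideal.IsPrime.ne_top inferInstance)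
  have h2 : h u ∈ (⨅ i : ℕ, (maximalIdeal R)^i • (⊤ : Submodule R L)) :=
    (Submodule.mem_iInf _).2 fun n => hpow n h u
  rw [this] at h2
  simpa using h2

theorem semilinear_ne_zero {R : Type} [CommRing R] [IsNoetherianRing R]
    (p e : ℕ) [ExpChar R p] (L : Type) [AddCommGroup L] [Module R L]
    (Q : PrimeSpectrum R) (hQ : Q.asIdeal ∈ associatedPrimes R L)
    (K : Type) [AddCommGroup K] [Module R K] [Module.Finite R K] (hK : Q ∈ Module.support R K) :
    ∃ h : K →ₛₗ[iterateFrobenius R p e] L, h ≠ 0 := by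
  have h1 : ¬ Subsingleton (K →ₗ[R] (R ⧸ Q.asIdeal)) := by
    rw [IsSMulRegular.subsingleton_linearMap_iff]
    rintro ⟨r, hr, hreg⟩
    have hrQ : r ∈ Q.asIdeal := Module.mem_support_iff_of_finite.mp hK hr
    have h3 : r • (1 : R ⧸ Q.asIdeal) = r • 0 := by
      rw [smul_zero]
      change Ideal.Quotient.mk Q.asIdeal (r * 1) = 0
      rw [mul_one]
      exact Ideal.Quotient.eq_zero_iff_mem.2 hrQ
    exact one_ne_zero (hreg h3)
  have h2 : ∃ ℓ : K →ₗ[R] (R ⧸ Q.asIdeal), ℓ ≠ 0 := by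
    by_contra hcon
    push Not at hcon
    exact h1 (subsingleton_of_forall_eq 0 hcon)
  obtain ⟨ℓ, hℓ⟩ := h2
  obtain ⟨j, hj⟩ : ∃ j : (R ⧸ Q.asIdeal) →ₗ[R] L, Function.Injective j := by
    obtain ⟨l, hl⟩ := (isAssociatedPrime_iff.mp (AssociatedPrimes.mem_iff.mp hQ)).2
    have hl' : Q.asIdeal = LinearMap.ker (LinearMap.toSpanSingleton R L l) :=
      hl.trans (by simp [SetLike.ext_iff])
    refine ⟨Submodule.liftQ _ (LinearMap.toSpanSingleton R L l) hl'.le, ?_⟩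
    rw [← LinearMap.ker_eq_bot]
    exact Submodule.ker_liftQ_eq_bot _ _ _ hl'.ge
  let ψ : (R ⧸ Q.asIdeal) →+* (R ⧸ Q.asIdeal) := Ideal.quotientMap Q.asIdeal (iterateFrobenius R p e)
    (fun r hr => by
      rw [Ideal.mem_comap, iterateFrobenius_def]
      exact Ideal.pow_mem_of_mem _ hr _ (expChar_pow_pos R p e))
  have hψ : ∀ a, ψ a = a ^ (p ^ e) := by
    intro a
    obtain ⟨a, rfl⟩ := Ideal.Quotient.mk_surjective a
    simp [ψ, iterateFrobenius_def]
  refine ⟨{ toFun := fun u => j (ψ (ℓ u)), map_add' := by simp, map_smul' := ?_ }, ?_⟩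
  · intro r u
    have e1 : ψ (ℓ (r • u)) = iterateFrobenius R p e r • ψ (ℓ u) := by
      rw [ℓ.map_smul, Algebra.smul_def, Algebra.smul_def, map_mul]
      congr 1
    change j (ψ (ℓ (r • u))) = iterateFrobenius R p e r • j (ψ (ℓ u))
    rw [e1, j.map_smul]
  · intro h0
    apply hℓ
    ext u
    have := congrArg (fun h => h u) h0
    have h3 : j (ψ (ℓ u)) = j 0 := by rw [map_zero]; exact this
    have h4 := hj h3
    rw [hψ] at h4
    exact eq_zero_of_pow_eq_zero h4

theorem ext_extends {R : Type} [CommRing R] (φ : R →+* R) (F Z : Type) [AddCommGroup F] [Module R F]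
    [AddCommGroup Z] [Module R Z] (f : F →ₗ[R] Z) (hf : Function.Surjective f) (L : ModuleCat.{0} R)
    (h1 : Subsingleton (Abelian.Ext (ModuleCat.of R Z) ((ModuleCat.restrictScalars φ).obj L) 1))
    (h : LinearMap.ker f →ₛₗ[φ] L) : ∃ g : F →ₛₗ[φ] L, ∀ u : LinearMap.ker f, g u = h u := by
  have hS := LinearMap.shortExact_shortComplexKer hf
  let h' : ModuleCat.of R (LinearMap.ker f) ⟶ (ModuleCat.restrictScalars φ).obj L :=
    ModuleCat.ofHom (Y := (ModuleCat.restrictScalars φ).obj L)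
      { toFun := fun u => (h u : L), map_add' := fun u v => map_add h u v,
        map_smul' := fun r u => map_smulₛₗ h r u }
  obtain ⟨x, hx⟩ := Abelian.Ext.contravariant_sequence_exact₁ hS _ (Abelian.Ext.mk₀ h') (add_zero 1) (h1.elim _ _)
  obtain ⟨g, rfl⟩ := (Abelian.Ext.mk₀_bijective _ _).2 x
  rw [Abelian.Ext.mk₀_comp_mk₀] at hx
  have hg := (Abelian.Ext.mk₀_bijective _ _).1 hx
  let g' : F →ₗ[R] (ModuleCat.restrictScalars φ).obj L := g.hom
  refine ⟨
    { toFun := fun u => (g' u : L)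
      map_add' := fun u v => map_add g' u v
      map_smul' := fun r u => map_smul g' r u }, fun u => ?_⟩
  exact congrArg (fun k => k.hom u) hg

theorem withBot_cancel (x : WithBot ℕ∞) (n : ℕ) (h : x + (n : WithBot ℕ∞) = ((n + 1 : ℕ) : WithBot ℕ∞)) : x = 1 := by
  induction x with
  | bot => simp at h; exact absurd h (by exact_mod_cast WithBot.bot_ne_coe)
  | coe x =>
    induction x with
    | top => exact absurd h (by
        intro h
        have h2 : ((⊤ + (n : ℕ∞) : ℕ∞) : WithBot ℕ∞) = ((n + 1 : ℕ) : ℕ∞) := h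
        rw [WithBot.coe_inj, top_add] at h2
        exact ENat.top_ne_natCast _ h2)
    | coe x =>
      have h2 : ((x : ℕ∞) + (n : ℕ∞) : ℕ∞) = ((n + 1 : ℕ) : ℕ∞) := by exact_mod_cast h
      have h3 : x + n = n + 1 := by exact_mod_cast h2
      have : x = 1 := by omega
      subst this
      rfl

theorem residue_ann (R : Type) [CommRing R] [IsLocalRing R] :
    Module.annihilator R (ResidueField R) = maximalIdeal R :=
  Ideal.annihilator_quotient

theorem exists_regular {R : Type} [CommRing R] [IsNoetherianRing R] [IsLocalRing R]
    (L : ModuleCat.{0} R) [Module.Finite R L]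
    (h : Subsingleton (Abelian.Ext (ModuleCat.of R (ResidueField R)) L 0)) :
    ∃ y ∈ maximalIdeal R, IsSMulRegular L y := by
  have hsub : Subsingleton (ModuleCat.of R (ResidueField R) ⟶ L) :=
    Abelian.Ext.addEquiv₀.subsingleton_congr.mp h
  have hsub' : Subsingleton (ResidueField R →ₗ[R] L) :=
    (ModuleCat.homAddEquiv (M := ModuleCat.of R (ResidueField R)) (N := L)).symm.subsingleton
  obtain ⟨x, hxann, hx⟩ := IsSMulRegular.subsingleton_linearMap_iff.mp hsub'
  rw [residue_ann] at hxann
  exact ⟨x, hxann, hx⟩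

theorem exists_Q {R : Type} [CommRing R] [IsNoetherianRing R] [IsLocalRing R]
    (hdep : ∃ y ∈ maximalIdeal R, IsSMulRegular R y)
    (n : ℕ) (K : Submodule R (Fin n → R)) (hK : K ≠ ⊥) :
    ∃ Q : PrimeSpectrum R, Q.asIdeal ≠ maximalIdeal R ∧ Q ∈ Module.support R K ∧
      ∀ P : Ideal R, P.IsPrime → Q.asIdeal < P → P = maximalIdeal R := by
  obtain ⟨y, hym, hy⟩ := hdep
  have : Nontrivial K := (Submodule.nontrivial_iff_ne_bot).2 hK
  obtain ⟨P, hP⟩ := associatedPrimes.nonempty R K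
  have hP' := isAssociatedPrime_iff.mp (AssociatedPrimes.mem_iff.mp hP)
  have hPm : P ≠ maximalIdeal R := by
    rintro rfl
    obtain ⟨hPp, l, hl⟩ := hP'
    have hyl : y • l = 0 := by
      have : y ∈ maximalIdeal R := hym
      rw [hl] at this
      simpa using this
    have hl0 : l = 0 := by
      ext i
      apply hy
      have := congrFun (congrArg Subtype.val hyl) i
      simpa using this
    apply hPp.ne_top
    rw [hl, hl0]
    ext; simp
  obtain ⟨Q, ⟨hQp, hQm, hPQ⟩, hQmax⟩ := set_has_maximal_iff_noetherian.mpr (inferInstanceAs (IsNoetherian R R))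
    {Q : Ideal R | Q.IsPrime ∧ Q ≠ maximalIdeal R ∧ P ≤ Q} ⟨P, hP'.1, hPm, le_rfl⟩
  refine ⟨⟨Q, hQp⟩, hQm, ?_, ?_⟩
  · rw [Module.mem_support_iff_of_finite]
    refine le_trans ?_ hPQ
    have := (AssociatedPrimes.mem_iff.mp hP).annihilator_le
    rwa [Submodule.annihilator_top] at this
  · intro P' hP'p hlt
    by_contra hne
    exact hQmax P' ⟨hP'p, hne, hPQ.trans hlt.le⟩ hlt

theorem core {R : Type} [CommRing R] [IsNoetherianRing R] [IsLocalRing R]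
    (p : ℕ) [Fact p.Prime] [ExpChar R p] (d : ℕ) (hd : ringKrullDim R = d)
    (hdep : Subsingleton (Abelian.Ext (ModuleCat.of R (ResidueField R)) (ModuleCat.of R R) 0))
    (M : ModuleCat.{0} R) [Module.Finite R M] (hsupp : Module.support R M = Set.univ)
    (rs : List R) (hlen : rs.length = d) (hrs : ∀ r ∈ rs, r ∈ maximalIdeal R)
    (hreg : RingTheory.Sequence.IsRegular M rs)
    (Z : Type) [AddCommGroup Z] [Module R Z] [Module.Finite R Z]
    (E : ℕ) (hvan : ∀ e ≥ E, ∀ i, 1 ≤ i → i < 1 + d → Subsingleton (Abelian.Ext (ModuleCat.of R Z)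
      ((ModuleCat.restrictScalars (iterateFrobenius R p e)).obj M) i)) :
    HasProjectiveDimensionLT (ModuleCat.of R Z) 1 := by
  have hnt : Nontrivial M := by
    rw [← Module.nonempty_support_iff (R := R), hsupp]
    exact ⟨closedPoint R, trivial⟩
  obtain ⟨b, f, hf, hker⟩ := exists_minimal_cover R Z
  have hK : LinearMap.ker f = ⊥ := by
    by_contra hK
    obtain ⟨Q, hQm, hQK, hQmax⟩ := exists_Q (exists_regular (ModuleCat.of R R) hdep) b _ hK
    have hQlt : Q < closedPoint R :=
      lt_of_le_of_ne (IsLocalRing.le_maximalIdeal Q.2.ne_top)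
        (fun h => hQm (congrArg PrimeSpectrum.asIdeal h))
    have hd1 : 1 ≤ d := by
      have h1 := Order.LTSeries.length_le_krullDim
        (RelSeries.fromListIsChain [Q, closedPoint R] (by simp) (by simpa using hQlt) : LTSeries (PrimeSpectrum R))
      have h2 : Order.krullDim (PrimeSpectrum R) = d := hd
      rw [h2] at h1
      have : (1 : WithBot ℕ∞) ≤ d := by simpa using h1
      exact_mod_cast this
    obtain ⟨c, rfl⟩ := Nat.exists_eq_add_of_le' hd1
    obtain ⟨L, hLfin, hQL, hLdim, hLtrans⟩ := exists_L Q c M (by rw [hsupp]; trivial)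
      (fun i hi => ischebeck Q hQm hQmax M rs hrs hreg i (by omega))
    have hMdim : Module.supportDim R M = ((c + 1 : ℕ) : WithBot ℕ∞) := by
      rw [← hd, ringKrullDim]
      unfold Module.supportDim
      rw [hsupp]
      exact Order.krullDim_eq_of_orderIso (OrderIso.Set.univ)
    rw [hMdim] at hLdim
    have hL1 := withBot_cancel _ _ hLdim
    have hmt : maximalIdeal R • (⊤ : Submodule R M) < ⊤ :=
      (Submodule.top_ne_ideal_smul_of_le_jacobson_annihilator
        (IsLocalRing.maximalIdeal_le_jacobson _)).symm.lt_top
    have hkM : ∀ i < c + 1, Subsingleton (Abelian.Ext (ModuleCat.of R (ResidueField R)) M i) := by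
      intro i hi
      refine ModuleCat.subsingleton_ext_of_exists_isRegular (maximalIdeal R) _ ?_ M hmt rs hrs hreg i (by omega)
      rw [Module.support_eq_zeroLocus]
      exact PrimeSpectrum.zeroLocus_anti_mono (residue_ann R).ge
    obtain ⟨y, hym, hy⟩ := exists_regular L (hLtrans (𝟭 _) (ModuleCat.of R (ResidueField R)) 0 1
      (fun i _ hi => hkM i (by omega)) 0 le_rfl (by omega))
    have hqdim := Module.supportDim_quotSMulTop_succ_eq_supportDim hy hym
    rw [hL1] at hqdim
    have hq0 : Module.supportDim R (QuotSMulTop y L) = 0 := by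
      generalize Module.supportDim R (QuotSMulTop y L) = x at hqdim
      induction x with
      | bot => simp at hqdim
      | coe x =>
        induction x with
        | top => exact absurd hqdim (by decide)
        | coe x =>
          have h3 : x + 1 = 1 := by exact_mod_cast hqdim
          have : x = 0 := by omega
          subst this
          rfl
    have hsq := support_of_supportDim_eq_zero R (QuotSMulTop y L) hq0
    rw [Module.support_eq_zeroLocus] at hsq
    have hrad : maximalIdeal R ≤ (Module.annihilator R (QuotSMulTop y L)).radical := by
      rw [← PrimeSpectrum.vanishingIdeal_zeroLocus_eq_radical, hsq, PrimeSpectrum.vanishingIdeal_zeroLocus_eq_radical]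
      exact Ideal.le_radical
    obtain ⟨n, hn⟩ := Ideal.exists_pow_le_of_le_radical_of_fg hrad (IsNoetherian.noetherian _)
    have hpp : 1 < p := (Fact.out : p.Prime).one_lt
    let e := max E n
    have hne : n ≤ p ^ e := (le_max_right E n).trans (Nat.lt_pow_self hpp).le
    have hφ : ∀ r ∈ maximalIdeal R, ∀ l : L, ∃ l', iterateFrobenius R p e r • l = y • l' := by
      intro r hr l
      have h1 : r ^ p ^ e ∈ Module.annihilator R (QuotSMulTop y L) :=
        hn (Ideal.pow_le_pow_right hne (Ideal.pow_mem_pow hr _))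
      have h2 := Module.mem_annihilator.1 h1 (Submodule.Quotient.mk l)
      rw [← Submodule.Quotient.mk_smul, Submodule.Quotient.mk_eq_zero] at h2
      obtain ⟨l', _, hl'⟩ := h2
      exact ⟨l', by rw [iterateFrobenius_def]; exact hl'.symm⟩
    have hExt := hLtrans (ModuleCat.restrictScalars (iterateFrobenius R p e)) (ModuleCat.of R Z) 1 1
      (fun i h1 h2 => hvan e (le_max_left _ _) i h1 (by omega)) 1 le_rfl (by omega)
    have hQass : Q.asIdeal ∈ associatedPrimes R L := by
      apply Module.associatedPrimes.minimalPrimes_annihilator_subset_associatedPrimes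
      refine ⟨⟨Q.2, Module.mem_support_iff_of_finite.1 hQL⟩, ?_⟩
      rintro P ⟨hPp, hPann⟩ hPQ
      by_contra hnot
      have hPQ' : (⟨P, hPp⟩ : PrimeSpectrum R) < Q := lt_of_le_not_ge hPQ hnot
      have h1 := Order.LTSeries.length_le_krullDim
        (RelSeries.fromListIsChain [⟨⟨P, hPp⟩, Module.mem_support_iff_of_finite.2 hPann⟩, ⟨Q, hQL⟩,
          ⟨closedPoint R, Module.mem_support_mono hQlt.le hQL⟩] (by simp) (by
            simpa using ⟨hPQ', hQlt⟩) : LTSeries (Module.support R L))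
      have h2 : Order.krullDim (Module.support R L) = 1 := hL1
      rw [h2] at h1
      have h3 : ((2 : ℕ) : WithBot ℕ∞) ≤ (1 : ℕ) := by simpa using h1
      have : 2 ≤ 1 := by exact_mod_cast h3
      omega
    obtain ⟨h, hh⟩ := semilinear_ne_zero p e L Q hQass (LinearMap.ker f) hQK
    exact hh (semilinear_zero (iterateFrobenius R p e) (Fin b → R) L y hym hy hφ _ hker
      (fun h => ext_extends _ _ _ f hf L hExt h) h)
  rw [← projective_iff_hasProjectiveDimensionLT_one, ← IsProjective.iff_projective]
  exact Module.Projective.of_equiv (LinearEquiv.ofBijective f ⟨LinearMap.ker_eq_bot.1 hK, hf⟩)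

theorem main_induct {R : Type} [CommRing R] [IsNoetherianRing R] [IsLocalRing R]
    (p : ℕ) [Fact p.Prime] [ExpChar R p] (d : ℕ) (hd : ringKrullDim R = d)
    (hdep : Subsingleton (Abelian.Ext (ModuleCat.of R (ResidueField R)) (ModuleCat.of R R) 0))
    (M : ModuleCat.{0} R) [Module.Finite R M] (hsupp : Module.support R M = Set.univ)
    (rs : List R) (hlen : rs.length = d) (hrs : ∀ r ∈ rs, r ∈ maximalIdeal R)
    (hreg : RingTheory.Sequence.IsRegular M rs) (E : ℕ) (t : ℕ) :
    ∀ (Z : Type) [AddCommGroup Z] [Module R Z] [Module.Finite R Z],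
    (∀ e ≥ E, ∀ i, t + 1 ≤ i → i < t + 1 + d → Subsingleton (Abelian.Ext (ModuleCat.of R Z)
      ((ModuleCat.restrictScalars (iterateFrobenius R p e)).obj M) i)) →
    HasProjectiveDimensionLT (ModuleCat.of R Z) (t + 1) := by
  induction t with
  | zero =>
    intro Z _ _ _ h
    exact core p d hd hdep M hsupp rs hlen hrs hreg Z E (by simpa using h)
  | succ t ih =>
    intro Z _ _ _ h
    obtain ⟨b, f, hf, hker⟩ := exists_minimal_cover R Z
    have hS := LinearMap.shortExact_shortComplexKer hf
    have hproj : Projective (ModuleCat.of R (Fin b → R)) := inferInstance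
    have hK := ih (LinearMap.ker f) (fun e he i h1 h2 => by
      have hz := h e he (1 + i) (by omega) (by omega)
      refine subsingleton_of_forall_eq 0 fun y => ?_
      obtain ⟨z, hz'⟩ := Abelian.Ext.contravariant_sequence_exact₁ hS _ y rfl (hz.elim _ _)
      have hz0 : z = 0 := by
        obtain ⟨i, rfl⟩ := Nat.exists_eq_add_of_le' (show 1 ≤ i by omega)
        exact Abelian.Ext.eq_zero_of_projective (P := ModuleCat.of R (Fin b → R)) z
      rw [hz0, Abelian.Ext.comp_zero] at hz'
      exact hz'.symm)
    exact (hS.hasProjectiveDimensionLT_X₃_iff t hproj).2 hK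

/-- If `R` is a `d`-dimensional Noetherian local ring of characteristic `p` with
`depth R = s ≥ 1`, `M` is a finitely generated Cohen-Macaulay module with full support,
`N` is finitely generated, and `Ext_R^i(N, ᵉM) = 0` for `i = t, …, t+d−1` for all `e ≫ 0`,
then `pd_R N ≤ min{t−1, depth R}`. -/
theorem stmt_16 (R : Type) [CommRing R] [IsNoetherianRing R] [IsLocalRing R]
    (p : ℕ) [Fact p.Prime] [CharP R p]
    (d : ℕ) (hd : ringKrullDim R = d)
    -- `depth R = s`:
    (s : ℕ) (hs : (∀ i < s, Subsingleton (extGroup R i (ResidueField R) R)) ∧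
      ¬ Subsingleton (extGroup R s (ResidueField R) R))
    (hs1 : 1 ≤ s)
    (M : Type) [AddCommGroup M] [Module R M] [Module.Finite R M]
    (hsupp : Module.support R M = Set.univ)
    -- `M` is Cohen-Macaulay (a regular sequence of length `d = dim M`):
    (hCM : ∃ rs : List R, rs.length = d ∧ (∀ r ∈ rs, r ∈ maximalIdeal R) ∧
      RingTheory.Sequence.IsRegular M rs)
    (N : Type) [AddCommGroup N] [Module R N] [Module.Finite R N]
    (t : ℕ) (ht : 1 ≤ t)
    (hvanish : ∃ E : ℕ, ∀ e ≥ E, ∀ i, t ≤ i → i < t + d →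
      Subsingleton (extGroup R i N (FrobTwist R p e M))) :
    projDimLE R N (min (t - 1) s) := by
  obtain ⟨rs, hlen, hrs, hreg⟩ := hCM
  obtain ⟨E, hE⟩ := hvanish
  obtain ⟨t, rfl⟩ := Nat.exists_eq_add_of_le' ht
  have conv : ∀ (A B : ModuleCat.{0} R) (i : ℕ),
      Subsingleton (((Ext R (ModuleCat R) i).obj (Opposite.op A)).obj B) →
      Subsingleton (Abelian.Ext A B i) := by
    intro A B i h
    rcases Nat.eq_zero_or_pos i with rfl | hi
    · exact old_zero A B h
    · exact (old_iff_new A B i hi).1 h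
  have hs2 : ∀ i < s, Subsingleton (Abelian.Ext (ModuleCat.of R (ResidueField R)) (ModuleCat.of R R) i) :=
    fun i hi => conv _ _ i (hs.1 i hi)
  have hs3 : ¬ Subsingleton (Abelian.Ext (ModuleCat.of R (ResidueField R)) (ModuleCat.of R R) s) :=
    fun h => hs.2 ((old_iff_new _ _ s hs1).2 h)
  have hpd := main_induct p d hd (hs2 0 (by omega)) (ModuleCat.of R M) hsupp rs hlen hrs hreg E t N
    (fun e he i h1 h2 => conv _ _ i (hE e he i h1 h2))
  have hpd2 := auslander_buchsbaum s hs1 hs2 hs3 t 0 (Nat.zero_le _) N hpd (fun i hi => absurd hi (by omega))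
  intro X i hi
  rw [old_iff_new _ _ i (by omega)]
  refine subsingleton_of_forall_eq 0 fun x => ?_
  rcases Nat.lt_or_ge t i with h | h
  · exact x.eq_zero_of_hasProjectiveDimensionLT (t + 1) h
  · exact x.eq_zero_of_hasProjectiveDimensionLT (s - 0 + 1) (by omega)
end

section
/- Let (R, m, k) be a commutative Noetherian local ring, M and N finitely generated R-modules, and n ≥ 1 an integer. Assume: (i) N_p is free over R_p for every prime p ≠ m; (ii) depth_R(M ⊗_R N) ≥ n; (iii) depth_R(M) ≥ n−1. Then Ext_R^i(Tr N, M) = 0 for all i = 1, …, n. -/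
open CategoryTheory IsLocalRing

lemma extGroup_iff (R : Type) [CommRing R] (n : ℕ)
    (A B : Type) [AddCommGroup A] [Module R A] [AddCommGroup B] [Module R B]
    (P : ProjectiveResolution (ModuleCat.of R A)) :
    Subsingleton (extGroup R n A B) ↔
      (P.complex.linearYonedaObj R (ModuleCat.of R B)).ExactAt n := by
  rw [HomologicalComplex.exactAt_iff_isZero_homology,
    ← (P.isoExt (R := R) n (ModuleCat.of R B)).isZero_iff, ModuleCat.isZero_iff_subsingleton]
  rfl

lemma extGroup_succ_iff (R : Type) [CommRing R] (n : ℕ)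
    (A B : Type) [AddCommGroup A] [Module R A] [AddCommGroup B] [Module R B] :
    Subsingleton (extGroup R (n+1) A B) ↔
      Subsingleton (Abelian.Ext (ModuleCat.of R A) (ModuleCat.of R B) (n+1)) := by
  let P := projectiveResolution (ModuleCat.of R A)
  rw [extGroup_iff R (n+1) A B P, HomologicalComplex.exactAt_iff' _ n (n+1) (n+2) (by simp) (by simp),
    ShortComplex.moduleCat_exact_iff]
  constructor
  · intro h
    refine subsingleton_of_forall_eq 0 fun α => ?_
    obtain ⟨f, hf, rfl⟩ := P.extMk_surjective α (n+2) rfl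
    rw [P.extMk_eq_zero_iff f (n+2) rfl hf n rfl]
    exact h f hf
  · intro h f hf
    exact (P.extMk_eq_zero_iff f (n+2) rfl hf n rfl).1 (Subsingleton.elim _ _)

lemma ext_of_extGroup (R : Type) [CommRing R] (n : ℕ)
    (A B : Type) [AddCommGroup A] [Module R A] [AddCommGroup B] [Module R B]
    (h : Subsingleton (extGroup R n A B)) :
      Subsingleton (Abelian.Ext (ModuleCat.of R A) (ModuleCat.of R B) n) := by
  cases n with
  | succ n => exact (extGroup_succ_iff R n A B).1 h
  | zero =>
    let P := projectiveResolution (ModuleCat.of R A)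
    rw [extGroup_iff R 0 A B P, HomologicalComplex.exactAt_iff' _ 0 0 1 (by simp) (by simp),
      ShortComplex.moduleCat_exact_iff] at h
    refine subsingleton_of_forall_eq 0 fun α => ?_
    obtain ⟨f, hf, rfl⟩ := P.extMk_surjective α 1 rfl
    obtain ⟨g, hg⟩ := h f hf
    have : f = 0 := by
      rw [← hg]
      change P.complex.d 0 0 ≫ g = 0
      rw [P.complex.shape _ _ (by simp)]; exact Limits.zero_comp
    subst this
    simp

section
variable {R : Type} [CommRing R]

/-- Ext into `Hom(F, M)` vanishes. -/
lemma ext_hom_free (F M A : Type) [AddCommGroup F] [Module R F] [Module.Free R F]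
    [Module.Finite R F] [AddCommGroup M] [Module R M] [AddCommGroup A] [Module R A] (i : ℕ)
    (h : Subsingleton (Abelian.Ext (ModuleCat.of R A) (ModuleCat.of R M) i)) :
    Subsingleton (Abelian.Ext (ModuleCat.of R A) (ModuleCat.of R (F →ₗ[R] M)) i) := by
  refine subsingleton_of_forall_eq 0 fun α => ?_
  let b := Module.Free.chooseBasis R F
  let e : Module.Free.ChooseBasisIndex R F →
      (ModuleCat.of R (F →ₗ[R] M) ⟶ ModuleCat.of R M) := fun j =>
    ModuleCat.ofHom (LinearMap.applyₗ (b j))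
  let s : Module.Free.ChooseBasisIndex R F →
      (ModuleCat.of R M ⟶ ModuleCat.of R (F →ₗ[R] M)) := fun j =>
    ModuleCat.ofHom (LinearMap.smulRightₗ (b.coord j))
  have key : ∑ j, e j ≫ s j = 𝟙 (ModuleCat.of R (F →ₗ[R] M)) := by
    apply ModuleCat.hom_ext
    refine LinearMap.ext fun f => b.ext fun k => ?_
    rw [ModuleCat.hom_sum, LinearMap.sum_apply, LinearMap.sum_apply]
    simp [e, s, Finsupp.single_apply, ite_smul]
  rw [← Abelian.Ext.comp_mk₀_id α, ← key, Abelian.Ext.mk₀_sum, Abelian.Ext.comp_sum]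
  refine Finset.sum_eq_zero fun j _ => ?_
  rw [← Abelian.Ext.mk₀_comp_mk₀, ← Abelian.Ext.comp_assoc_of_third_deg_zero,
    Subsingleton.elim (α.comp (Abelian.Ext.mk₀ (e j)) (add_zero i)) 0, Abelian.Ext.zero_comp]

/-- The third term of a short exact sequence. -/
lemma ext_third (A X Y Z : Type) [AddCommGroup A] [Module R A] [AddCommGroup X] [Module R X]
    [AddCommGroup Y] [Module R Y] [AddCommGroup Z] [Module R Z]
    (f : X →ₗ[R] Y) (g : Y →ₗ[R] Z) (hf : Function.Injective f) (hg : Function.Surjective g)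
    (hfg : Function.Exact f g) (i : ℕ)
    (hY : Subsingleton (Abelian.Ext (ModuleCat.of R A) (ModuleCat.of R Y) i))
    (hX : Subsingleton (Abelian.Ext (ModuleCat.of R A) (ModuleCat.of R X) (i+1))) :
    Subsingleton (Abelian.Ext (ModuleCat.of R A) (ModuleCat.of R Z) i) := by
  let S : ShortComplex (ModuleCat R) := ShortComplex.mk (ModuleCat.ofHom f) (ModuleCat.ofHom g)
    (by rw [← ModuleCat.ofHom_comp, hfg.linearMap_comp_eq_zero]; rfl)
  have hS : S.ShortExact :=
    { exact := (ShortComplex.ShortExact.moduleCat_exact_iff_function_exact S).2 hfg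
      mono_f := (ModuleCat.mono_iff_injective _).2 hf
      epi_g := (ModuleCat.epi_iff_surjective _).2 hg }
  refine subsingleton_of_forall_eq 0 fun α => ?_
  have hX' : Subsingleton (Abelian.Ext (ModuleCat.of R A) S.X₁ (i+1)) := hX
  have hY' : Subsingleton (Abelian.Ext (ModuleCat.of R A) S.X₂ i) := hY
  obtain ⟨β, rfl⟩ := Abelian.Ext.covariant_sequence_exact₃ (ModuleCat.of R A) hS α rfl
    (Subsingleton.elim _ _)
  rw [Subsingleton.elim β 0, Abelian.Ext.zero_comp]

/-- dimension shifting. -/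
lemma ext_shift (M F T : Type) [AddCommGroup M] [Module R M] [AddCommGroup F] [Module R F]
    [Module.Free R F]
    [AddCommGroup T] [Module R T] (p : F →ₗ[R] T) (hp : Function.Surjective p) (K : Submodule R F)
    (hK : LinearMap.ker p = K) (i : ℕ)
    (h : Subsingleton (Abelian.Ext (ModuleCat.of R K) (ModuleCat.of R M) i)) :
    Subsingleton (Abelian.Ext (ModuleCat.of R T) (ModuleCat.of R M) (i+1)) := by
  subst hK
  let S := p.shortComplexKer
  have hS : S.ShortExact := LinearMap.shortExact_shortComplexKer hp
  have : Projective S.X₂ := (IsProjective.iff_projective (R := R) (P := F)).1 inferInstance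
  refine subsingleton_of_forall_eq 0 fun α => ?_
  obtain ⟨β, rfl⟩ := precomp_extClass_surjective_of_projective_X₂ (ModuleCat.of R M) hS i α
  have h' : Subsingleton (Abelian.Ext S.X₁ (ModuleCat.of R M) i) := h
  rw [Subsingleton.elim β 0, map_zero]

lemma ext_one (M F T : Type) [AddCommGroup M] [Module R M] [AddCommGroup F] [Module R F]
    [Module.Free R F]
    [AddCommGroup T] [Module R T] (p : F →ₗ[R] T) (hp : Function.Surjective p) (K : Submodule R F)
    (hK : LinearMap.ker p = K)
    (h : ∀ f : K →ₗ[R] M, ∃ g : F →ₗ[R] M, g ∘ₗ K.subtype = f) :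
    Subsingleton (Abelian.Ext (ModuleCat.of R T) (ModuleCat.of R M) 1) := by
  subst hK
  let S := p.shortComplexKer
  have hS : S.ShortExact := LinearMap.shortExact_shortComplexKer hp
  have : Projective S.X₂ := (IsProjective.iff_projective (R := R) (P := F)).1 inferInstance
  refine subsingleton_of_forall_eq 0 fun α => ?_
  obtain ⟨β, rfl⟩ := precomp_extClass_surjective_of_projective_X₂ (ModuleCat.of R M) hS 0 α
  obtain ⟨β, rfl⟩ := Abelian.Ext.addEquiv₀.symm.surjective β
  obtain ⟨g, hg⟩ := h β.hom
  have : β = S.f ≫ ModuleCat.ofHom g := by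
    apply ModuleCat.hom_ext; exact hg.symm
  rw [this]
  change hS.extClass.comp (Abelian.Ext.mk₀ _) (add_comm 1 0) = 0
  rw [← Abelian.Ext.mk₀_comp_mk₀]
  exact hS.extClass_comp_assoc (Abelian.Ext.mk₀ (ModuleCat.ofHom g))

lemma torsion_zero [IsLocalRing R] (Y : Type) [AddCommGroup Y] [Module R Y]
    (h : Subsingleton (Abelian.Ext (ModuleCat.of R (ResidueField R)) (ModuleCat.of R Y) 0))
    (k : ℕ) (y : Y) (hy : ∀ r ∈ maximalIdeal R ^ k, r • y = 0) : y = 0 := by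
  have h1 : Subsingleton (ModuleCat.of R (ResidueField R) ⟶ ModuleCat.of R Y) :=
    Abelian.Ext.addEquiv₀.subsingleton_congr.mp h
  have h2 : Subsingleton (ResidueField R →ₗ[R] Y) := 
    (ModuleCat.homAddEquiv (M := ModuleCat.of R (ResidueField R))
      (N := ModuleCat.of R Y)).symm.subsingleton
  induction k generalizing y with
  | zero => simpa using hy 1 (by simp)
  | succ k ih =>
    apply ih
    intro s hs
    let φ : (R ⧸ maximalIdeal R) →ₗ[R] Y :=
      (maximalIdeal R).liftQ (LinearMap.toSpanSingleton R Y (s • y)) (by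
        intro t ht
        rw [LinearMap.mem_ker, LinearMap.toSpanSingleton_apply, smul_smul]
        exact hy _ (by rw [pow_succ, mul_comm t s]; exact Ideal.mul_mem_mul hs ht))
    have h3 : φ = 0 := @Subsingleton.elim _ h2 φ 0
    have := LinearMap.congr_fun h3 (Submodule.Quotient.mk (1:R))
    have h4 : φ (Submodule.Quotient.mk (1:R)) = (1 : R) • (s • y) := rfl
    rw [h4, one_smul] at this
    exact this


lemma exists_syzygy [IsNoetherianRing R] (F₁ F₀ : Type) [AddCommGroup F₁] [Module R F₁]
    [Module.Finite R F₁] [AddCommGroup F₀] [Module R F₀] (a : F₁ →ₗ[R] F₀) :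
    ∃ (m : ℕ) (b : (Fin m → R) →ₗ[R] F₁), LinearMap.range b = LinearMap.ker a := by
  have : Module.Finite R (LinearMap.ker a) := inferInstance
  obtain ⟨m, f, hf⟩ := Module.Finite.exists_fin' R (LinearMap.ker a)
  refine ⟨m, (LinearMap.ker a).subtype ∘ₗ f, ?_⟩
  rw [LinearMap.range_comp, LinearMap.range_eq_top.2 hf, Submodule.map_top, Submodule.range_subtype]

/-- Lifting through the kernel. -/
lemma exists_lift_of_comp_zero {P A B C : Type} [AddCommGroup P] [Module R P] [Module.Free R P]
    [AddCommGroup A] [Module R A] [AddCommGroup B] [Module R B] [AddCommGroup C] [Module R C]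
    (b : A →ₗ[R] B) (a : B →ₗ[R] C) (hab : LinearMap.range b = LinearMap.ker a)
    (u : P →ₗ[R] B) (hu : a ∘ₗ u = 0) : ∃ h : P →ₗ[R] A, b ∘ₗ h = u := by
  have hu' : ∀ x, u x ∈ LinearMap.range b := fun x => by
    rw [hab]; exact LinearMap.congr_fun hu x
  obtain ⟨h, hh⟩ := Module.projective_lifting_property b.rangeRestrict (u.codRestrict _ hu')
    b.surjective_rangeRestrict
  exact ⟨h, LinearMap.ext fun x => congrArg Subtype.val (LinearMap.congr_fun hh x)⟩

lemma key [IsLocalRing R] [IsNoetherianRing R] (M : Type) [AddCommGroup M] [Module R M] (k : ℕ)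
    (n : ℕ) : ∀ (F₁ F₀ T Y : Type) [AddCommGroup F₁] [Module R F₁] [Module.Free R F₁]
    [Module.Finite R F₁] [AddCommGroup F₀] [Module R F₀] [Module.Free R F₀] [Module.Finite R F₀]
    [AddCommGroup T] [Module R T] [AddCommGroup Y] [Module R Y]
    (a : F₁ →ₗ[R] F₀) (p : F₀ →ₗ[R] T) (_ : Function.Surjective p)
    (_ : LinearMap.ker p = LinearMap.range a)
    (q : (F₁ →ₗ[R] M) →ₗ[R] Y) (_ : Function.Surjective q)
    (_ : LinearMap.ker q = LinearMap.range (LinearMap.lcomp R M a))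
    (_ : ∀ r ∈ maximalIdeal R ^ k, ∃ h : F₀ →ₗ[R] F₁, a ∘ₗ h ∘ₗ a = r • a)
    (_ : ∀ i < n,
      Subsingleton (Abelian.Ext (ModuleCat.of R (ResidueField R)) (ModuleCat.of R Y) i))
    (_ : ∀ i < n - 1,
      Subsingleton (Abelian.Ext (ModuleCat.of R (ResidueField R)) (ModuleCat.of R M) i)),
    ∀ i < n, Subsingleton (Abelian.Ext (ModuleCat.of R T) (ModuleCat.of R M) (i + 1)) := by
  induction n with
  | zero => intros; omega
  | succ n ih =>
    intro F₁ F₀ T Y _ _ _ _ _ _ _ _ _ _ _ _ a p hp hpa q hq hqa hI hY hM i hi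
    obtain ⟨m, b, hb⟩ := exists_syzygy F₁ F₀ a
    have hab : a ∘ₗ b = 0 := by
      ext x
      have : b (Pi.single x 1) ∈ LinearMap.ker a := hb ▸ LinearMap.mem_range_self b _
      simpa using this
    have hI' : ∀ r ∈ maximalIdeal R ^ k, ∃ (h : F₀ →ₗ[R] F₁) (h' : F₁ →ₗ[R] (Fin m → R)),
        b ∘ₗ h' = r • LinearMap.id - h ∘ₗ a := by
      intro r hr
      obtain ⟨h, hh⟩ := hI r hr
      obtain ⟨h', hh'⟩ := exists_lift_of_comp_zero b a hb (r • LinearMap.id - h ∘ₗ a) (by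
        rw [LinearMap.comp_sub, hh, LinearMap.comp_smul, LinearMap.comp_id, sub_self])
      exact ⟨h, h', hh'⟩
    have hex : ∀ f : F₁ →ₗ[R] M, f ∘ₗ b = 0 → q f = 0 := by
      intro f hf
      refine torsion_zero Y (hY 0 (by omega)) k _ fun r hr => ?_
      obtain ⟨h, h', hh⟩ := hI' r hr
      rw [← map_smul, ← LinearMap.mem_ker, hqa]
      refine ⟨f ∘ₗ h, ?_⟩
      have := congrArg (fun u => f ∘ₗ u) hh
      simp only [← LinearMap.comp_assoc, hf, LinearMap.zero_comp, LinearMap.comp_sub,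
        LinearMap.comp_smul, LinearMap.comp_id] at this
      exact (sub_eq_zero.1 this.symm).symm
    cases i with
    | zero =>
      refine ext_one M F₀ T p hp _ hpa fun f => ?_
      have h1 := hex (f ∘ₗ a.rangeRestrict) (by
        ext x
        have : a.rangeRestrict (b (Pi.single x 1)) = 0 := by
          apply Subtype.ext
          exact LinearMap.congr_fun hab (Pi.single x 1)
        simp [this])
      rw [← LinearMap.mem_ker, hqa] at h1
      obtain ⟨g, hg⟩ := h1
      refine ⟨g, LinearMap.ext fun x => ?_⟩
      obtain ⟨y, rfl⟩ := a.surjective_rangeRestrict x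
      exact LinearMap.congr_fun hg y
    | succ i =>
      refine ext_shift M F₀ T p hp _ hpa (i+1) ?_
      let Y' := ((Fin m → R) →ₗ[R] M) ⧸ LinearMap.range (LinearMap.lcomp R M b)
      have hle : LinearMap.ker q ≤ LinearMap.ker (LinearMap.lcomp R M b) := by
        rw [hqa]
        rintro _ ⟨g, rfl⟩
        rw [LinearMap.mem_ker]
        change (g ∘ₗ a) ∘ₗ b = 0
        rw [LinearMap.comp_assoc, hab, LinearMap.comp_zero]
      obtain ⟨j, hj⟩ : ∃ j : Y →ₗ[R] ((Fin m → R) →ₗ[R] M), j ∘ₗ q = LinearMap.lcomp R M b := by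
        refine ⟨(LinearMap.ker q).liftQ _ hle ∘ₗ
          (q.quotKerEquivOfSurjective hq).symm.toLinearMap, LinearMap.ext fun f => ?_⟩
        have : (q.quotKerEquivOfSurjective hq).symm (q f) = Submodule.Quotient.mk f := by
          rw [LinearEquiv.symm_apply_eq]; rfl
        simp [this]
      have hY' : ∀ i < n, Subsingleton
          (Abelian.Ext (ModuleCat.of R (ResidueField R)) (ModuleCat.of R Y') i) := by
        intro i hi
        refine ext_third (ResidueField R) Y ((Fin m → R) →ₗ[R] M) Y' j (Submodule.mkQ _) ?_
          (Submodule.mkQ_surjective _) ?_ i (ext_hom_free _ _ _ _ (hM i (by omega)))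
          (hY _ (by omega))
        · rw [injective_iff_map_eq_zero]
          intro y hy
          obtain ⟨f, rfl⟩ := hq y
          exact hex f ((LinearMap.congr_fun hj f).symm.trans hy)
        · rw [LinearMap.exact_iff, Submodule.ker_mkQ, ← hj, LinearMap.range_comp,
            LinearMap.range_eq_top.2 hq, Submodule.map_top]
      exact ih (Fin m → R) F₁ (LinearMap.range a) Y' b a.rangeRestrict a.surjective_rangeRestrict
        (by rw [LinearMap.ker_rangeRestrict, hb]) (Submodule.mkQ _) (Submodule.mkQ_surjective _)
        (Submodule.ker_mkQ _) (fun r hr => by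
          obtain ⟨h, h', hh⟩ := hI' r hr
          refine ⟨h', ?_⟩
          rw [← LinearMap.comp_assoc, hh, LinearMap.sub_comp, LinearMap.comp_assoc, hab,
            LinearMap.comp_zero, sub_zero, LinearMap.smul_comp, LinearMap.id_comp]) hY'
        (fun i hi => hM i (by omega)) i (by omega)

lemma exists_pow [IsLocalRing R] [IsNoetherianRing R]
    (N : Type) [AddCommGroup N] [Module R N] [Module.Finite R N]
    (hfree : ∀ P : PrimeSpectrum R, P.asIdeal ≠ maximalIdeal R →
      Module.Free (Localization P.asIdeal.primeCompl)
        (LocalizedModule P.asIdeal.primeCompl N))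
    (P₀ : Type) [AddCommGroup P₀] [Module R P₀] [Module.Free R P₀]
    (P₁ : Type) [AddCommGroup P₁] [Module R P₁]
    (d : P₁ →ₗ[R] P₀) (g : P₀ →ₗ[R] N)
    (hg : Function.Surjective g)
    (hexact : LinearMap.range d = LinearMap.ker g) :
    ∃ k, ∀ r ∈ maximalIdeal R ^ k, ∃ h : P₀ →ₗ[R] P₁, d ∘ₗ h ∘ₗ d = r • d := by
  let I : Ideal R :=
    { carrier := {r | ∃ h : P₀ →ₗ[R] P₁, d ∘ₗ h ∘ₗ d = r • d}
      add_mem' := by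
        rintro x y ⟨h, hh⟩ ⟨h', hh'⟩
        exact ⟨h + h', by rw [LinearMap.add_comp, LinearMap.comp_add, hh, hh', add_smul]⟩
      zero_mem' := ⟨0, by simp⟩
      smul_mem' := by
        rintro c x ⟨h, hh⟩
        exact ⟨c • h, by
          rw [LinearMap.smul_comp, LinearMap.comp_smul, hh, smul_smul, smul_eq_mul]⟩ }
  have hgd : g ∘ₗ d = 0 := by
    ext x
    have : d x ∈ LinearMap.ker g := hexact ▸ LinearMap.mem_range_self d x
    simpa using this
  have hI : ∀ P : PrimeSpectrum R, P.asIdeal ≠ maximalIdeal R → ¬ I ≤ P.asIdeal := by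
    intro P hP hle
    have := hfree P hP
    let S := P.asIdeal.primeCompl
    let gS : LocalizedModule S P₀ →ₗ[Localization S] LocalizedModule S N := LocalizedModule.map S g
    have hgS : Function.Surjective gS := LocalizedModule.map_surjective S g hg
    obtain ⟨σ, hσ⟩ := Module.projective_lifting_property gS LinearMap.id hgS
    have : Module.FinitePresentation R N := Module.finitePresentation_of_finite R N
    obtain ⟨τ, s, hτ⟩ := Module.FinitePresentation.exists_lift_of_isLocalizedModule S
      (LocalizedModule.mkLinearMap S P₀) (σ.restrictScalars R ∘ₗ LocalizedModule.mkLinearMap S N)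
    obtain ⟨t, ht⟩ := Module.Finite.exists_smul_of_comp_eq_of_isLocalizedModule S
      (LocalizedModule.mkLinearMap S N) (g ∘ₗ τ) (s • LinearMap.id) (by
        ext x
        have h1 : LocalizedModule.mkLinearMap S P₀ (τ x) =
            (s : R) • σ (LocalizedModule.mkLinearMap S N x) := LinearMap.congr_fun hτ x
        have h2 := congrArg (gS.restrictScalars R) h1
        have h3 : gS (σ (LocalizedModule.mkLinearMap S N x)) =
          LocalizedModule.mkLinearMap S N x :=
          LinearMap.congr_fun hσ (LocalizedModule.mkLinearMap S N x)
        have h4 : gS (LocalizedModule.mkLinearMap S P₀ (τ x)) =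
          LocalizedModule.mkLinearMap S N (g (τ x)) := by
          simp [gS, LocalizedModule.mkLinearMap_apply]
        rw [map_smul] at h2
        simp only [LinearMap.coe_restrictScalars] at h2
        rw [h3, h4] at h2
        change LocalizedModule.mkLinearMap S N (g (τ x)) =
          LocalizedModule.mkLinearMap S N ((s : R) • x)
        rw [h2, map_smul])
    have hts : ((t * s : S) : R) ∈ I := by
      obtain ⟨h, hh⟩ := exists_lift_of_comp_zero d g hexact
        (((t * s : S) : R) • LinearMap.id - (t : R) • (τ ∘ₗ g)) (by
          ext x
          have h1 := LinearMap.congr_fun ht (g x)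
          simp [Submonoid.smul_def] at h1
          simp [h1, mul_smul])
      refine ⟨h, ?_⟩
      rw [← LinearMap.comp_assoc, hh, LinearMap.sub_comp, LinearMap.smul_comp, LinearMap.smul_comp,
        LinearMap.comp_assoc, hgd, LinearMap.comp_zero, smul_zero, sub_zero, LinearMap.id_comp]
    exact (t * s).2 (hle hts)
  have hrad : maximalIdeal R ≤ I.radical := by
    rw [Ideal.radical_eq_sInf]
    refine le_sInf ?_
    rintro J ⟨hJ, hJp⟩
    by_contra hc
    exact hI ⟨J, hJp⟩ (fun h => hc (le_of_eq h.symm)) hJ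
  obtain ⟨k, hk⟩ := Ideal.exists_pow_le_of_le_radical_of_fg hrad (IsNoetherian.noetherian _)
  exact ⟨k, fun r hr => hk hr⟩

/-- `m ⊗ p ↦ (φ ↦ φ(p) m)` as an equivalence. -/
noncomputable def tensorHomDual (M P : Type) [AddCommGroup M] [Module R M]
    [AddCommGroup P] [Module R P] [Module.Free R P] [Module.Finite R P] :
    TensorProduct R M P ≃ₗ[R] (Module.Dual R P →ₗ[R] M) :=
  (TensorProduct.comm R M P) ≪≫ₗ
    (TensorProduct.congr (Module.evalEquiv R P) (LinearEquiv.refl R M)) ≪≫ₗ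
    dualTensorHomEquiv (R := R) (M := Module.Dual R P) (N := M)

lemma tensorHomDual_tmul (M P : Type) [AddCommGroup M] [Module R M]
    [AddCommGroup P] [Module R P] [Module.Free R P] [Module.Finite R P] (m : M) (x : P)
    (φ : Module.Dual R P) : tensorHomDual (R := R) M P (m ⊗ₜ x) φ = φ x • m := by
  simp [tensorHomDual]

end

theorem stmt_19 (R : Type) [CommRing R] [IsNoetherianRing R] [IsLocalRing R]
    (M : Type) [AddCommGroup M] [Module R M] [Module.Finite R M]
    (N : Type) [AddCommGroup N] [Module R N] [Module.Finite R N]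
    (n : ℕ) (hn : 1 ≤ n)
    (hfree : ∀ P : PrimeSpectrum R, P.asIdeal ≠ maximalIdeal R →
      Module.Free (Localization P.asIdeal.primeCompl)
        (LocalizedModule P.asIdeal.primeCompl N))
    (hdepthMN : ∀ i < n,
      Subsingleton (extGroup R i (ResidueField R) (TensorProduct R M N)))
    (hdepthM : ∀ i < n - 1, Subsingleton (extGroup R i (ResidueField R) M))
    -- a minimal free presentation `P₁ →d P₀ →g N → 0`:
    (P₀ : Type) [AddCommGroup P₀] [Module R P₀] [Module.Free R P₀] [Module.Finite R P₀]
    (P₁ : Type) [AddCommGroup P₁] [Module R P₁] [Module.Free R P₁] [Module.Finite R P₁]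
    (d : P₁ →ₗ[R] P₀) (g : P₀ →ₗ[R] N)
    (hg : Function.Surjective g)
    (hexact : LinearMap.range d = LinearMap.ker g)
    (hmin₀ : LinearMap.ker g ≤ (maximalIdeal R) • (⊤ : Submodule R P₀))
    (hmin₁ : LinearMap.ker d ≤ (maximalIdeal R) • (⊤ : Submodule R P₁)) :
    ∀ i, 1 ≤ i → i ≤ n →
      Subsingleton (extGroup R i
        ((Module.Dual R P₁) ⧸ LinearMap.range d.dualMap) M) := by
  intro i hi hin
  obtain ⟨i, rfl⟩ : ∃ j, i = j + 1 := ⟨i - 1, by omega⟩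
  rw [extGroup_succ_iff]
  obtain ⟨k, hk⟩ := exists_pow N hfree P₀ P₁ d g hg hexact
  let q : (Module.Dual R P₀ →ₗ[R] M) →ₗ[R] TensorProduct R M N :=
    g.lTensor M ∘ₗ (tensorHomDual (R := R) M P₀).symm.toLinearMap
  have hcomm : (tensorHomDual (R := R) M P₀).toLinearMap ∘ₗ d.lTensor M =
      LinearMap.lcomp R M d.dualMap ∘ₗ (tensorHomDual (R := R) M P₁).toLinearMap := by
    refine TensorProduct.ext' fun m x => LinearMap.ext fun φ => ?_
    simp [tensorHomDual_tmul]
  have hlex : LinearMap.ker (g.lTensor M) = LinearMap.range (d.lTensor M) :=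
    LinearMap.exact_iff.1 (lTensor_exact M (LinearMap.exact_iff.2 hexact.symm) hg)
  refine key M k n (Module.Dual R P₀) (Module.Dual R P₁) _ (TensorProduct R M N) d.dualMap
    (Submodule.mkQ _) (Submodule.mkQ_surjective _) (Submodule.ker_mkQ _) q
    ((LinearMap.lTensor_surjective M hg).comp (LinearEquiv.surjective _)) ?_ ?_
    (fun i hi => ext_of_extGroup R i _ _ (hdepthMN i hi))
    (fun i hi => ext_of_extGroup R i _ _ (hdepthM i hi)) i (by omega)
  · ext f
    obtain ⟨x, rfl⟩ := (tensorHomDual (R := R) M P₀).surjective f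
    have h1 : tensorHomDual (R := R) M P₀ x ∈ LinearMap.ker q ↔
        x ∈ LinearMap.range (d.lTensor M) := by
      rw [← hlex]; simp [q]
    rw [h1]
    constructor
    · rintro ⟨y, rfl⟩
      exact ⟨tensorHomDual (R := R) M P₁ y, (LinearMap.congr_fun hcomm y).symm⟩
    · rintro ⟨y, hy⟩
      obtain ⟨y, rfl⟩ := (tensorHomDual (R := R) M P₁).surjective y
      refine ⟨y, (tensorHomDual (R := R) M P₀).injective ?_⟩
      exact (LinearMap.congr_fun hcomm y).trans hy
  · intro r hr
    obtain ⟨h, hh⟩ := hk r hr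
    refine ⟨h.dualMap, ?_⟩
    ext φ x
    have := congrArg φ (LinearMap.congr_fun hh x)
    simpa using this
end
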